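/- arXiv:1911.10292 — 4 statements merged into one kernel-verified Lean document; each statement's English description precedes it below -/
import Mathlib

section
/- Let n ≥ 1, let Ω ⊂ ℝⁿ be a nonempty open bounded set, let 0 < δ ≤ 1, and set η := (2/(n+1))·(ℋ^{n−1}(B₁^{n−1})/ℋⁿ(B₁ⁿ)). Define the correspondence Ψ(x) := B_δ(x) ∩ {y ∈ ℝⁿ : (y−x)·e₁ > 0} for x ∈ Ω, and set Γ := closure(⋃_{x∈Ω} Ψ(x)) \ Ω. If u ∈ L¹(ℝⁿ) satisfies u = 0 a.e. on Γ, then ∫_Ω |u(x)|² dx ≤ (4(1+diam Ω)³/η²) · ∫_Ω | ⨍_{Ψ(x)} (u(y)−u(x))/δ dy |² dx, where ⨍ denotes the average (integral divided by the Lebesgue measure of the domain of integration). -/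
open MeasureTheory Metric Set
open scoped ENNReal NNReal

/-- An Eilenberg-type inequality: if every fibre of `p` over `[0, 1]` meets `S` in a set that `q` maps
onto `A`, then the dimension of `S` exceeds that of `A` by one, quantitatively. -/
theorem hausdorffMeasure_le_hausdorffMeasure_add_one {X Y : Type*}
    [EMetricSpace X] [MeasurableSpace X] [BorelSpace X]
    [EMetricSpace Y] [MeasurableSpace Y] [BorelSpace Y]
    {p : X → ℝ} {q : X → Y} (hp : LipschitzWith 1 p) (hq : LipschitzWith 1 q)
    {S : Set X} {A : Set Y} (hS : ∀ t ∈ Icc (0 : ℝ) 1, ∀ y ∈ A, ∃ x ∈ S, p x = t ∧ q x = y)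
    {d : ℝ} (hd : 0 ≤ d) : μH[d] A ≤ μH[d + 1] S := by
  rw [Measure.hausdorffMeasure_apply, Measure.hausdorffMeasure_apply]
  refine iSup₂_mono fun r hr => le_iInf₂ fun T hT => le_iInf fun hTr => ?_
  set L : ℝ≥0∞ := ⨅ (t : ℕ → Set Y) (_ : A ⊆ ⋃ n, t n) (_ : ∀ n, ediam (t n) ≤ r),
          ∑' n, ⨆ _ : (t n).Nonempty, ediam (t n) ^ d
  have slice_diam : ∀ (s : ℝ) (i : ℕ), ediam (q '' (T i ∩ p ⁻¹' {s})) ≤ ediam (T i) := by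
    intro s i
    refine (hq.ediam_image_le _).trans ?_
    simpa using ediam_mono inter_subset_left
  have pointwise : ∀ s ∈ Icc (0 : ℝ) 1,
      L ≤ ∑' i, (closure (p '' T i)).indicator (fun _ => ediam (T i) ^ d) s := by
    intro s hs
    refine (iInf₂_le (fun i => q '' (T i ∩ p ⁻¹' {s})) ?_).trans
      ((iInf_le _ fun i => (slice_diam s i).trans (hTr i)).trans ?_)
    · intro y hy
      obtain ⟨x, hxS, hpx, hqx⟩ := hS s hs y hy
      obtain ⟨i, hi⟩ := mem_iUnion.1 (hT hxS)
      exact mem_iUnion.2 ⟨i, x, ⟨hi, hpx⟩, hqx⟩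
    · refine ENNReal.tsum_le_tsum fun i => iSup_le ?_
      rintro ⟨-, x, ⟨hx, hxs⟩, -⟩
      have hs' : s ∈ closure (p '' T i) := subset_closure ⟨x, hx, hxs⟩
      rw [indicator_of_mem hs']
      exact ENNReal.rpow_le_rpow (slice_diam s i) hd
  calc L = ∫⁻ _ in Icc (0 : ℝ) 1, L := by simp
    _ ≤ ∫⁻ s in Icc (0 : ℝ) 1,
          ∑' i, (closure (p '' T i)).indicator (fun _ => ediam (T i) ^ d) s :=
        setLIntegral_mono' measurableSet_Icc pointwise
    _ ≤ ∫⁻ s, ∑' i, (closure (p '' T i)).indicator (fun _ => ediam (T i) ^ d) s :=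
        setLIntegral_le_lintegral _ _
    _ = ∑' i, ediam (T i) ^ d * volume (closure (p '' T i)) := by
        rw [lintegral_tsum fun i =>
          (measurable_const.indicator isClosed_closure.measurableSet).aemeasurable]
        simp [lintegral_indicator_const isClosed_closure.measurableSet]
    _ ≤ _ := by
        refine ENNReal.tsum_le_tsum fun i => ?_
        rcases (T i).eq_empty_or_nonempty with h | h
        · simp [h]
        · refine le_iSup_of_le h ?_
          rw [ENNReal.rpow_add_of_nonneg _ _ hd zero_le_one, ENNReal.rpow_one]
          gcongr
          refine (Real.volume_le_diam _).trans ?_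
          rw [ediam_closure]
          simpa using hp.ediam_image_le (T i)

theorem ofReal_average_sq_le {α : Type*} [MeasurableSpace α] {μ : Measure α} {s : Set α}
    (hs0 : μ s ≠ 0) (hs : μ s ≠ ∞) {f : α → ℝ} (hf : AEStronglyMeasurable f (μ.restrict s)) :
    ENNReal.ofReal ((⨍ y in s, f y ∂μ) ^ 2) ≤
      (μ s)⁻¹ * ∫⁻ y in s, ENNReal.ofReal (f y ^ 2) ∂μ := by
  have := ProbabilityTheory.cond_isProbabilityMeasure_of_finite hs0 hs
  set ν := (μ s)⁻¹ • μ.restrict s with hν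
  have : IsProbabilityMeasure ν := this
  have sq (r : ℝ) : ENNReal.ofReal (r ^ 2) = ‖r‖ₑ ^ 2 := by
    rw [← sq_abs, ENNReal.ofReal_pow (abs_nonneg r), Real.enorm_eq_ofReal_abs]
  simp only [sq]
  rw [setAverage_eq', ← smul_eq_mul, ← lintegral_smul_measure, ← hν]
  have h2 := eLpNorm_nnreal_pow_eq_lintegral (f := f) (μ := ν) (p := 2) two_ne_zero
  simp only [NNReal.coe_ofNat, ENNReal.rpow_ofNat, ENNReal.coe_ofNat] at h2
  rw [← h2]
  gcongr
  refine (enorm_integral_le_lintegral_enorm f).trans ?_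
  rw [← eLpNorm_one_eq_lintegral_enorm]
  exact eLpNorm_le_eLpNorm_of_exponent_le (by norm_num) (hf.smul_measure _)

/-- Averages of `g` over the translates of `H` lose a fixed amount of energy against a linear
weight, when `H` lies on average on the positive side of `ℓ`. -/
theorem lintegral_weight_average_add_le {E : Type*} [NormedAddCommGroup E] [NormedSpace ℝ E]
    [MeasurableSpace E] [BorelSpace E] [SecondCountableTopology E] {μ : Measure E} [SFinite μ]
    [μ.IsAddLeftInvariant]
    (ℓ : E →L[ℝ] ℝ) (a : ℝ) {Ω H : Set E} (hH : MeasurableSet H)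
    (hH0 : μ H ≠ 0) (hHtop : μ H ≠ ∞) (hℓH : ∀ h ∈ H, 0 ≤ ℓ h)
    (hw : ∀ y ∈ Ω, ∀ h ∈ H, 0 ≤ ℓ y - a - ℓ h) {c : ℝ≥0∞}
    (hc : μ H * c ≤ ∫⁻ h in H, ENNReal.ofReal (ℓ h) ∂μ)
    {g : E → ℝ≥0∞} (hg : Measurable g) (hgΩ : ∀ y ∉ Ω, g y = 0) :
    ∫⁻ x in Ω, ENNReal.ofReal (ℓ x - a) * ((μ H)⁻¹ * ∫⁻ h in H, g (x + h) ∂μ) ∂μ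
      + c * ∫⁻ y, g y ∂μ ≤ ∫⁻ y, ENNReal.ofReal (ℓ y - a) * g y ∂μ := by
  have hw' : ∀ y ∈ Ω, (μ H)⁻¹ * ∫⁻ h in H, ENNReal.ofReal (ℓ y - a - ℓ h) ∂μ + c ≤
      ENNReal.ofReal (ℓ y - a) := by
    intro y hy
    calc _ ≤ (μ H)⁻¹ * ∫⁻ h in H, ENNReal.ofReal (ℓ y - a - ℓ h) ∂μ +
          (μ H)⁻¹ * ∫⁻ h in H, ENNReal.ofReal (ℓ h) ∂μ := by
          gcongr
          rw [← ENNReal.mul_le_iff_le_inv hH0 hHtop]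
          exact hc
      _ = (μ H)⁻¹ * ∫⁻ h in H, ENNReal.ofReal (ℓ y - a) ∂μ := by
          rw [← mul_add, ← lintegral_add_right _ (by fun_prop)]
          congr 1
          refine setLIntegral_congr_fun hH fun h hh => ?_
          rw [← ENNReal.ofReal_add (hw y hy h hh) (hℓH h hh)]
          ring_nf
      _ = _ := by
          rw [setLIntegral_const, mul_comm, mul_assoc, ENNReal.mul_inv_cancel hH0 hHtop, mul_one]
  have key : ∫⁻ x in Ω, ENNReal.ofReal (ℓ x - a) * ((μ H)⁻¹ * ∫⁻ h in H, g (x + h) ∂μ) ∂μ ≤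
      ∫⁻ y, ((μ H)⁻¹ * ∫⁻ h in H, ENNReal.ofReal (ℓ y - a - ℓ h) ∂μ) * g y ∂μ := by
    calc _ ≤ ∫⁻ x, ENNReal.ofReal (ℓ x - a) * ((μ H)⁻¹ * ∫⁻ h in H, g (x + h) ∂μ) ∂μ :=
          setLIntegral_le_lintegral _ _
      _ = ∫⁻ x, (μ H)⁻¹ * ∫⁻ h in H, ENNReal.ofReal (ℓ x - a) * g (x + h) ∂μ ∂μ := by
          congr 1 with x
          rw [lintegral_const_mul _ (by fun_prop)]
          ring
      _ = (μ H)⁻¹ * ∫⁻ h in H, ∫⁻ x, ENNReal.ofReal (ℓ x - a) * g (x + h) ∂μ ∂μ := by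
          rw [lintegral_const_mul' _ _ (by simpa using hH0),
            lintegral_lintegral_swap (by fun_prop)]
      _ = (μ H)⁻¹ * ∫⁻ h in H, ∫⁻ y, ENNReal.ofReal (ℓ y - a - ℓ h) * g y ∂μ ∂μ := by
          congr 2 with h
          rw [← lintegral_add_left_eq_self (fun y => ENNReal.ofReal (ℓ y - a - ℓ h) * g y) h]
          congr 1 with x
          rw [add_comm h x, map_add]
          ring_nf
      _ = _ := by
          rw [lintegral_lintegral_swap (by fun_prop),
            ← lintegral_const_mul' _ _ (by simpa using hH0)]
          congr 1 with y
          rw [lintegral_mul_const _ (by fun_prop)]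
          ring
  calc _ ≤ ∫⁻ y, ((μ H)⁻¹ * ∫⁻ h in H, ENNReal.ofReal (ℓ y - a - ℓ h) ∂μ) * g y ∂μ
        + ∫⁻ y, c * g y ∂μ := by
        rw [lintegral_const_mul _ hg]
        gcongr
    _ = ∫⁻ y, ((μ H)⁻¹ * ∫⁻ h in H, ENNReal.ofReal (ℓ y - a - ℓ h) ∂μ + c) * g y ∂μ := by
        rw [← lintegral_add_right _ (by fun_prop)]
        simp only [add_mul]
    _ ≤ _ := by
        refine lintegral_mono fun y => ?_
        by_cases hy : y ∈ Ω
        · exact mul_le_mul_left (hw' y hy) _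
        · simp [hgΩ y hy]

theorem measurePreserving_zero_tail (m : ℕ) :
    MeasurePreserving (fun x : EuclideanSpace ℝ (Fin (m + 1)) =>
      (x 0, (WithLp.toLp 2 (fun i => x i.succ) : EuclideanSpace ℝ (Fin m)))) := by
  have h1 := PiLp.volume_preserving_ofLp (Fin (m + 1))
  have h2 := volume_preserving_piFinSuccAbove (fun _ : Fin (m + 1) => ℝ) 0
  have h3 := (MeasurePreserving.id (volume : Measure ℝ)).prod
    (PiLp.volume_preserving_toLp (Fin m))
  exact h3.comp (h2.comp h1)

theorem norm_sq_eq_zero_tail {m : ℕ} (x : EuclideanSpace ℝ (Fin (m + 1))) :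
    ‖x‖ ^ 2 = x 0 ^ 2 + ‖(WithLp.toLp 2 (fun i => x i.succ) : EuclideanSpace ℝ (Fin m))‖ ^ 2 := by
  rw [EuclideanSpace.real_norm_sq_eq, EuclideanSpace.real_norm_sq_eq, Fin.sum_univ_succ]

theorem integral_mul_sqrt_sq_sub_sq_pow (m : ℕ) {δ : ℝ} (hδ : 0 < δ) :
    ∫ t in (0 : ℝ)..δ, t * √(δ ^ 2 - t ^ 2) ^ m = δ ^ (m + 2) / (m + 2) := by
  have hcont : Continuous fun t : ℝ => -(√(δ ^ 2 - t ^ 2) ^ (m + 2)) / (m + 2) := by fun_prop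
  rw [intervalIntegral.integral_eq_sub_of_hasDerivAt_of_le hδ.le hcont.continuousOn
    (fun t ht => ?_) (Continuous.intervalIntegrable (by fun_prop) _ _)]
  · simp [Real.sqrt_sq hδ.le, neg_div]
  · have hpos : 0 < δ ^ 2 - t ^ 2 := by nlinarith [ht.1, ht.2]
    have h1 : HasDerivAt (fun t : ℝ => δ ^ 2 - t ^ 2) (-(2 * t)) t := by
      simpa using ((hasDerivAt_id t).pow 2).const_sub (δ ^ 2)
    have h2 := (((h1.sqrt hpos.ne').pow (m + 2)).neg).div_const ((m : ℝ) + 2)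
    convert! h2 using 1
    have hs : √(δ ^ 2 - t ^ 2) ≠ 0 := (Real.sqrt_pos.2 hpos).ne'
    push_cast
    field_simp
    ring

theorem setLIntegral_coord_halfBall (m : ℕ) {δ : ℝ} (hδ : 0 < δ) :
    ∫⁻ h in ball (0 : EuclideanSpace ℝ (Fin (m + 1))) δ ∩ {h | 0 < h 0}, ENNReal.ofReal (h 0) =
      ENNReal.ofReal (δ ^ (m + 2) / (m + 2)) *
        volume (ball (0 : EuclideanSpace ℝ (Fin m)) 1) := by
  set S : Set (ℝ × EuclideanSpace ℝ (Fin m)) := {q | q.1 ^ 2 + ‖q.2‖ ^ 2 < δ ^ 2} ∩ {q | 0 < q.1}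
  have hS : MeasurableSet S :=
    ((isOpen_lt (by fun_prop) (by fun_prop)).inter
      (isOpen_lt (by fun_prop) (by fun_prop))).measurableSet
  have hpre : ball (0 : EuclideanSpace ℝ (Fin (m + 1))) δ ∩ {h | 0 < h 0} =
      (fun x : EuclideanSpace ℝ (Fin (m + 1)) =>
        (x 0, (WithLp.toLp 2 (fun i => x i.succ) : EuclideanSpace ℝ (Fin m)))) ⁻¹' S := by
    ext x
    simp only [S, mem_inter_iff, mem_ball_zero_iff, mem_ofPred_eq, mem_preimage,
      ← norm_sq_eq_zero_tail, sq_lt_sq₀ (norm_nonneg x) hδ.le]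
  have hslice : ∀ t ∈ Ioo 0 δ, volume (Prod.mk t ⁻¹' S) =
      ENNReal.ofReal (√(δ ^ 2 - t ^ 2) ^ m) * volume (ball (0 : EuclideanSpace ℝ (Fin m)) 1) := by
    intro t ht
    have hpos : 0 < δ ^ 2 - t ^ 2 := by nlinarith [ht.1, ht.2]
    have : Prod.mk t ⁻¹' S = ball (0 : EuclideanSpace ℝ (Fin m)) √(δ ^ 2 - t ^ 2) := by
      ext z
      simp only [S, mem_preimage, mem_inter_iff, mem_ofPred_eq, ht.1, and_true, mem_ball_zero_iff,
        Real.lt_sqrt (norm_nonneg z)]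
      exact lt_sub_iff_add_lt'.symm
    rw [this, Measure.addHaar_ball_of_pos _ _ (Real.sqrt_pos.2 hpos), finrank_euclideanSpace_fin]
  have hslice0 : ∀ t ∉ Ioo 0 δ, Prod.mk t ⁻¹' S = ∅ := by
    intro t ht
    refine eq_empty_of_forall_notMem fun z hz => ht ⟨hz.2, ?_⟩
    have : t ^ 2 + ‖z‖ ^ 2 < δ ^ 2 := hz.1
    exact lt_of_pow_lt_pow_left₀ 2 hδ.le (by nlinarith [sq_nonneg ‖z‖])
  calc _ = ∫⁻ q in S, ENNReal.ofReal q.1 := by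
        rw [hpre]
        exact (measurePreserving_zero_tail m).setLIntegral_comp_preimage hS
          (f := fun q => ENNReal.ofReal q.1) (by fun_prop)
    _ = ∫⁻ t, ENNReal.ofReal t * volume (Prod.mk t ⁻¹' S) := by
        rw [← lintegral_indicator hS, Measure.volume_eq_prod,
          lintegral_prod _ ((Measurable.indicator (by fun_prop) hS).aemeasurable)]
        congr 1 with t
        rw [← lintegral_indicator_const (hS.preimage (by fun_prop))]
        rfl
    _ = ∫⁻ t in Ioo 0 δ, ENNReal.ofReal (t * √(δ ^ 2 - t ^ 2) ^ m) *
          volume (ball (0 : EuclideanSpace ℝ (Fin m)) 1) := by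
        rw [← lintegral_indicator measurableSet_Ioo]
        congr 1 with t
        by_cases ht : t ∈ Ioo 0 δ
        · rw [indicator_of_mem ht, hslice t ht, ENNReal.ofReal_mul ht.1.le, mul_assoc]
        · simp [ht, hslice0 t ht]
    _ = _ := by
        rw [lintegral_mul_const _ (by fun_prop), ← integral_mul_sqrt_sq_sub_sq_pow m hδ,
          intervalIntegral.integral_of_le hδ.le, integral_Ioc_eq_integral_Ioo,
          ofReal_integral_eq_lintegral_ofReal]
        · exact (Continuous.integrableOn_Icc (by fun_prop)).mono_set Ioo_subset_Icc_self
        · filter_upwards [ae_restrict_mem measurableSet_Ioo] with t ht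
          exact mul_nonneg ht.1.le (by positivity)

theorem two_mul_volume_halfBall_le {n : ℕ} (i : Fin n) (δ : ℝ) :
    2 * volume (ball (0 : EuclideanSpace ℝ (Fin n)) δ ∩ {h | 0 < h i}) ≤
      volume (ball (0 : EuclideanSpace ℝ (Fin n)) δ) := by
  set H := ball (0 : EuclideanSpace ℝ (Fin n)) δ ∩ {h | 0 < h i}
  have hH : MeasurableSet H :=
    (isOpen_ball.inter (isOpen_lt (by fun_prop) (by fun_prop))).measurableSet
  have hdisj : Disjoint H (-H) := by
    rw [Set.disjoint_left]
    rintro x ⟨-, hx⟩ ⟨-, hx'⟩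
    simp only [mem_ofPred_eq, PiLp.neg_apply] at hx hx'
    linarith
  rw [two_mul]
  nth_rw 2 [← Measure.measure_neg]
  rw [← measure_union hdisj hH.neg]
  refine measure_mono (union_subset inter_subset_left ?_)
  rintro x ⟨hx, -⟩
  simpa using hx

theorem isAddHaarMeasure_hausdorffMeasure_natCast (n : ℕ) :
    (μH[(n : ℝ)] : Measure (EuclideanSpace ℝ (Fin n))).IsAddHaarMeasure := by
  simpa using isAddHaarMeasure_hausdorffMeasure (E := EuclideanSpace ℝ (Fin n))

/-- The Hausdorff measures of unit balls, normalised by Lebesgue measure, do not decrease with the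
dimension. -/
theorem hausdorffMeasure_ball_mul_volume_ball_le (m : ℕ) :
    μH[(m : ℝ)] (ball (0 : EuclideanSpace ℝ (Fin m)) 1) *
        volume (ball (0 : EuclideanSpace ℝ (Fin (m + 1))) 1) ≤
      μH[((m + 1 : ℕ) : ℝ)] (ball (0 : EuclideanSpace ℝ (Fin (m + 1))) 1) *
        volume (ball (0 : EuclideanSpace ℝ (Fin m)) 1) := by
  set e := fun x : EuclideanSpace ℝ (Fin (m + 1)) =>
    (x 0, (WithLp.toLp 2 (fun i => x i.succ) : EuclideanSpace ℝ (Fin m)))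
  have hvol : volume (e ⁻¹' (Icc (0 : ℝ) 1 ×ˢ ball (0 : EuclideanSpace ℝ (Fin m)) 1)) =
      volume (ball (0 : EuclideanSpace ℝ (Fin m)) 1) := by
    rw [(measurePreserving_zero_tail m).measure_preimage
      (measurableSet_Icc.prod measurableSet_ball).nullMeasurableSet, Measure.volume_eq_prod,
      Measure.prod_prod]
    simp
  have hle : μH[(m : ℝ)] (ball (0 : EuclideanSpace ℝ (Fin m)) 1) ≤
      μH[(m : ℝ) + 1] (e ⁻¹' (Icc (0 : ℝ) 1 ×ˢ ball (0 : EuclideanSpace ℝ (Fin m)) 1)) := by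
    refine hausdorffMeasure_le_hausdorffMeasure_add_one (p := fun x => (e x).1)
      (q := fun x => (e x).2) (LipschitzWith.of_dist_le_mul fun x y => ?_)
      (LipschitzWith.of_dist_le_mul fun x y => ?_) (fun t ht y hy => ?_) m.cast_nonneg
    · rw [NNReal.coe_one, one_mul, dist_eq_norm, dist_eq_norm]
      exact PiLp.norm_apply_le (x - y) 0
    · rw [NNReal.coe_one, one_mul, dist_eq_norm, dist_eq_norm]
      refine le_of_sq_le_sq ?_ (norm_nonneg _)
      rw [norm_sq_eq_zero_tail (x - y)]
      exact le_add_of_nonneg_left (sq_nonneg _)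
    · refine ⟨WithLp.toLp 2 (Fin.cons t y), ⟨?_, ?_⟩, ?_, ?_⟩
      all_goals simp_all [e]
  have := isAddHaarMeasure_hausdorffMeasure_natCast (m + 1)
  have hsmul := Measure.isAddLeftInvariant_eq_smul
    (μH[((m + 1 : ℕ) : ℝ)] : Measure (EuclideanSpace ℝ (Fin (m + 1)))) volume
  rw [← Nat.cast_succ, Nat.succ_eq_add_one, hsmul, Measure.smul_apply, hvol] at hle
  rw [hsmul, Measure.smul_apply]
  calc _ ≤ _ := mul_le_mul_left hle _
    _ = _ := by simp only [ENNReal.smul_def, smul_eq_mul]; ring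

/-- Nonlocal Poincaré inequality for difference quotients averaged over the translates of a set `H`
lying on average on the positive side of a linear functional `ℓ`. -/
theorem lintegral_sq_le_lintegral_average_diff_sq {E : Type*} [NormedAddCommGroup E]
    [NormedSpace ℝ E] [MeasurableSpace E] [BorelSpace E] [SecondCountableTopology E]
    {μ : Measure E} [SFinite μ] [μ.IsAddLeftInvariant]
    (ℓ : E →L[ℝ] ℝ) (a : ℝ) {Ω H : Set E} (hΩ : MeasurableSet Ω) (hΩtop : μ Ω ≠ ∞)
    (hH : MeasurableSet H) (hH0 : μ H ≠ 0) (hHtop : μ H ≠ ∞) (hℓH : ∀ h ∈ H, 0 ≤ ℓ h)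
    (hw : ∀ y ∈ Ω, ∀ h ∈ H, 0 ≤ ℓ y - a - ℓ h) {M δ η : ℝ} (hM : 0 < M) (hδ : 0 < δ) (hη : 0 < η)
    (hwM : ∀ y ∈ Ω, ℓ y - a ≤ M)
    (hmoment : μ H * ENNReal.ofReal (δ * η) ≤ ∫⁻ h in H, ENNReal.ofReal (ℓ h) ∂μ)
    {Ψ : E → Set E} (hΨm : ∀ x, MeasurableSet (Ψ x)) (hΨ : ∀ x, (x + ·) ⁻¹' Ψ x = H)
    {u : E → ℝ} (hu : Integrable u μ)
    (hu0 : ∀ x ∈ Ω, ∀ᵐ y ∂μ.restrict (Ψ x), y ∉ Ω → u y = 0) :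
    ∫⁻ x in Ω, ENNReal.ofReal (u x ^ 2) ∂μ ≤ ENNReal.ofReal (4 * M ^ 2 / η ^ 2) *
      ∫⁻ x in Ω, ENNReal.ofReal ((⨍ y in Ψ x, (u y - u x) / δ ∂μ) ^ 2) ∂μ := by
  set f : E → ℝ := fun x => ⨍ y in Ψ x, (u y - u x) / δ ∂μ with hf
  have hΨμ : ∀ x, μ (Ψ x) = μ H := fun x => by
    rw [← hΨ x, (measurePreserving_add_left μ x).measure_preimage (hΨm x).nullMeasurableSet]
  have hfu : ∀ x, ⨍ y in Ψ x, u y ∂μ = u x + δ * f x := by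
    intro x
    have hx0 : μ.real (Ψ x) ≠ 0 := by
      rw [measureReal_def, hΨμ]
      exact ENNReal.toReal_ne_zero.2 ⟨hH0, hHtop⟩
    have hxt : μ (Ψ x) ≠ ∞ := by rwa [hΨμ]
    simp only [hf, setAverage_eq, smul_eq_mul]
    rw [integral_div, integral_sub hu.integrableOn (integrableOn_const hxt), setIntegral_const,
      smul_eq_mul]
    field_simp
    ring
  set g : E → ℝ≥0∞ := Ω.indicator fun y => ENNReal.ofReal (hu.1.mk u y ^ 2) with hg
  have hgm : Measurable g :=
    (hu.1.stronglyMeasurable_mk.measurable.pow_const 2).ennreal_ofReal.indicator hΩ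
  have hg_eq : ∀ᵐ y ∂μ, y ∈ Ω → g y = ENNReal.ofReal (u y ^ 2) := by
    filter_upwards [hu.1.ae_eq_mk] with y hy hyΩ
    rw [hg, indicator_of_mem hyΩ, hy]
  have hgU : ∫⁻ y, g y ∂μ = ∫⁻ x in Ω, ENNReal.ofReal (u x ^ 2) ∂μ := by
    rw [hg, lintegral_indicator hΩ, ← setLIntegral_congr_fun_ae hΩ hg_eq]
    exact setLIntegral_congr_fun hΩ fun y hy => by simp [hg, hy]
  set K : E → ℝ≥0∞ := fun x => (μ H)⁻¹ * ∫⁻ h in H, g (x + h) ∂μ with hK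
  have hKm : Measurable K := by fun_prop
  have hjensen : ∀ x ∈ Ω, ENNReal.ofReal ((u x + δ * f x) ^ 2) ≤ K x := by
    intro x hx
    rw [← hfu]
    refine (ofReal_average_sq_le (by rwa [hΨμ]) (by rwa [hΨμ]) hu.1.restrict).trans_eq ?_
    rw [hΨμ, hK]
    congr 1
    rw [← hΨ x, (measurePreserving_add_left μ x).setLIntegral_comp_preimage (hΨm x) hgm]
    refine lintegral_congr_ae ?_
    filter_upwards [hu0 x hx, ae_restrict_of_ae hg_eq] with y hy hgy
    by_cases hyΩ : y ∈ Ω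
    · exact (hgy hyΩ).symm
    · simp [hg, hyΩ, hy hyΩ]
  set U := ∫⁻ x in Ω, ENNReal.ofReal (u x ^ 2) ∂μ
  set F := ∫⁻ x in Ω, ENNReal.ofReal (f x ^ 2) ∂μ
  rcases eq_or_ne F ∞ with hFtop | hFtop
  · rw [hFtop, ENNReal.mul_top (by simpa using by positivity)]
    exact le_top
  have hUtop : U ≠ ∞ := by
    set C : ℝ := (μ.real H)⁻¹ * ∫ y, ‖u y‖ ∂μ
    have hC : ∀ x, |u x + δ * f x| ≤ C := by
      intro x
      rw [← hfu, setAverage_eq, smul_eq_mul, abs_mul, abs_of_nonneg (by positivity)]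
      rw [measureReal_def, hΨμ, ← measureReal_def]
      refine mul_le_mul_of_nonneg_left ?_ (by positivity)
      exact (norm_integral_le_integral_norm u).trans
        (setIntegral_le_integral hu.norm (Filter.Eventually.of_forall fun _ => norm_nonneg _))
    have hpt : ∀ x, ENNReal.ofReal (u x ^ 2) ≤
        ENNReal.ofReal (2 * C ^ 2) + ENNReal.ofReal (2 * δ ^ 2) * ENNReal.ofReal (f x ^ 2) := by
      intro x
      rw [← ENNReal.ofReal_mul (by positivity), ← ENNReal.ofReal_add (by positivity) (by positivity)]
      refine ENNReal.ofReal_le_ofReal ?_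
      have := sq_le_sq' (abs_le.1 (hC x)).1 (abs_le.1 (hC x)).2
      nlinarith [sq_nonneg (u x + 2 * (δ * f x))]
    refine ne_top_of_le_ne_top ?_ (lintegral_mono hpt)
    rw [lintegral_add_left measurable_const, setLIntegral_const,
      lintegral_const_mul' _ _ ENNReal.ofReal_ne_top]
    exact ENNReal.add_ne_top.2 ⟨ENNReal.mul_ne_top ENNReal.ofReal_ne_top hΩtop,
      ENNReal.mul_ne_top ENNReal.ofReal_ne_top hFtop⟩
  set W := ∫⁻ y, ENNReal.ofReal (ℓ y - a) * g y ∂μ with hW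
  have hWtop : W ≠ ∞ := by
    refine ne_top_of_le_ne_top (ENNReal.mul_ne_top (ENNReal.ofReal_ne_top (r := M)) hUtop) ?_
    rw [← hgU, ← lintegral_const_mul _ hgm]
    refine lintegral_mono fun y => ?_
    by_cases hy : y ∈ Ω
    · exact mul_le_mul_left (ENNReal.ofReal_le_ofReal (hwM y hy)) _
    · simp [hg, hy]
  have henergy : ∫⁻ x in Ω, ENNReal.ofReal (ℓ x - a) * K x ∂μ + ENNReal.ofReal (δ * η) * U ≤ W := by
    rw [← hgU]
    exact lintegral_weight_average_add_le ℓ a hH hH0 hHtop hℓH hw hmoment hgm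
      fun y hy => by simp [hg, hy]
  have hpt : ∀ x ∈ Ω, ENNReal.ofReal (ℓ x - a) * ENNReal.ofReal (u x ^ 2) ≤
      (ENNReal.ofReal (ℓ x - a) * K x + ENNReal.ofReal (δ * η / 2) * ENNReal.ofReal (u x ^ 2)) +
        ENNReal.ofReal (2 * δ * M ^ 2 / η) * ENNReal.ofReal (f x ^ 2) := by
    intro x hx
    have hsplit : u x ^ 2 ≤ (u x + δ * f x) ^ 2 +
        (δ * η / 2 / M * u x ^ 2 + 2 * δ * M / η * f x ^ 2) := by
      have h1 : -(2 * u x * f x) ≤ η / (2 * M) * u x ^ 2 + 2 * M / η * f x ^ 2 := by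
        have : 0 ≤ η / (2 * M) * (u x + 2 * M / η * f x) ^ 2 := by positivity
        have h2 : η / (2 * M) * (u x + 2 * M / η * f x) ^ 2 =
          η / (2 * M) * u x ^ 2 + 2 * u x * f x + 2 * M / η * f x ^ 2 := by field_simp; ring
        linarith
      have h3 := mul_le_mul_of_nonneg_left h1 hδ.le
      have h4 : δ * (η / (2 * M) * u x ^ 2 + 2 * M / η * f x ^ 2) =
        δ * η / 2 / M * u x ^ 2 + 2 * δ * M / η * f x ^ 2 := by field_simp
      nlinarith [sq_nonneg (δ * f x)]
    calc _ ≤ ENNReal.ofReal (ℓ x - a) * (K x + ENNReal.ofReal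
          (δ * η / 2 / M * u x ^ 2 + 2 * δ * M / η * f x ^ 2)) := by
          gcongr
          refine (ENNReal.ofReal_le_ofReal hsplit).trans (ENNReal.ofReal_add_le.trans ?_)
          gcongr
          exact hjensen x hx
      _ ≤ ENNReal.ofReal (ℓ x - a) * K x + ENNReal.ofReal M * ENNReal.ofReal
          (δ * η / 2 / M * u x ^ 2 + 2 * δ * M / η * f x ^ 2) := by
          rw [mul_add]
          gcongr
          exact hwM x hx
      _ = _ := by
          rw [add_assoc, ← ENNReal.ofReal_mul hM.le, ← ENNReal.ofReal_mul (by positivity),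
            ← ENNReal.ofReal_mul (by positivity), ← ENNReal.ofReal_add (by positivity)
            (by positivity)]
          congr 2
          field_simp
  have hWle : W ≤ ∫⁻ x in Ω, ENNReal.ofReal (ℓ x - a) * K x ∂μ + ENNReal.ofReal (δ * η / 2) * U +
      ENNReal.ofReal (2 * δ * M ^ 2 / η) * F := by
    calc W = ∫⁻ x in Ω, ENNReal.ofReal (ℓ x - a) * ENNReal.ofReal (u x ^ 2) ∂μ := by
          rw [hW, ← setLIntegral_eq_of_support_subset (s := Ω)]
          · refine setLIntegral_congr_fun_ae hΩ ?_
            filter_upwards [hg_eq] with y hy hyΩ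
            rw [hy hyΩ]
          · intro y hy
            by_contra h
            simp [hg, h] at hy
      _ ≤ _ := setLIntegral_mono' hΩ hpt
      _ = _ := by
          rw [lintegral_add_left', lintegral_add_left (by fun_prop),
            lintegral_const_mul' _ _ ENNReal.ofReal_ne_top,
            lintegral_const_mul' _ _ ENNReal.ofReal_ne_top]
          have := hu.1.aemeasurable.restrict (s := Ω)
          fun_prop
  have hsplitη : ENNReal.ofReal (δ * η) * U =
      ENNReal.ofReal (δ * η / 2) * U + ENNReal.ofReal (δ * η / 2) * U := by
    rw [← add_mul, ← ENNReal.ofReal_add (by positivity) (by positivity), add_halves]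
  set X := ∫⁻ x in Ω, ENNReal.ofReal (ℓ x - a) * K x ∂μ
  have hXtop : X + ENNReal.ofReal (δ * η / 2) * U ≠ ∞ := by
    refine ne_top_of_le_ne_top hWtop (le_trans ?_ henergy)
    rw [hsplitη, ← add_assoc]
    exact le_self_add
  have hfinal : ENNReal.ofReal (δ * η / 2) * U ≤ ENNReal.ofReal (2 * δ * M ^ 2 / η) * F := by
    refine (ENNReal.add_le_add_iff_left hXtop).1 ?_
    rw [add_assoc, ← hsplitη]
    exact henergy.trans hWle
  calc U = ENNReal.ofReal (2 / (δ * η)) * (ENNReal.ofReal (δ * η / 2) * U) := by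
        rw [← mul_assoc, ← ENNReal.ofReal_mul (by positivity)]
        have : 2 / (δ * η) * (δ * η / 2) = 1 := by field_simp
        rw [this, ENNReal.ofReal_one, one_mul]
    _ ≤ ENNReal.ofReal (2 / (δ * η)) * (ENNReal.ofReal (2 * δ * M ^ 2 / η) * F) := by gcongr
    _ = _ := by
        rw [← mul_assoc, ← ENNReal.ofReal_mul (by positivity)]
        congr 2
        field_simp
        ring

theorem measureReal_unitBall_pos {n : ℕ} (μ : Measure (EuclideanSpace ℝ (Fin n)))
    [μ.IsAddHaarMeasure] : 0 < (μ (ball 0 1)).toReal :=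
  ENNReal.toReal_pos (measure_ball_pos μ 0 one_pos).ne' measure_ball_lt_top.ne

theorem volume_halfBall_mul_le_setLIntegral_coord (m : ℕ) {δ : ℝ} (hδ : 0 < δ) :
    volume (ball (0 : EuclideanSpace ℝ (Fin (m + 1))) δ ∩ {h | 0 < h 0}) *
      ENNReal.ofReal (δ * (2 / ((m : ℝ) + 2) *
        ((μH[(m : ℝ)] (ball (0 : EuclideanSpace ℝ (Fin m)) 1)).toReal /
          (μH[((m + 1 : ℕ) : ℝ)] (ball (0 : EuclideanSpace ℝ (Fin (m + 1))) 1)).toReal))) ≤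
      ∫⁻ h in ball (0 : EuclideanSpace ℝ (Fin (m + 1))) δ ∩ {h | 0 < h 0},
        ENNReal.ofReal (h 0) := by
  have := isAddHaarMeasure_hausdorffMeasure_natCast m
  have := isAddHaarMeasure_hausdorffMeasure_natCast (m + 1)
  rw [setLIntegral_coord_halfBall m hδ]
  have hhalf := two_mul_volume_halfBall_le (0 : Fin (m + 1)) δ
  rw [Measure.addHaar_ball_of_pos _ _ hδ, finrank_euclideanSpace_fin] at hhalf
  have hratio := ENNReal.toReal_mono
    (ENNReal.mul_ne_top measure_ball_lt_top.ne measure_ball_lt_top.ne)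
    (hausdorffMeasure_ball_mul_volume_ball_le m)
  have hhalf' := ENNReal.toReal_mono
    (ENNReal.mul_ne_top ENNReal.ofReal_ne_top measure_ball_lt_top.ne) hhalf
  have hHtop : volume (ball (0 : EuclideanSpace ℝ (Fin (m + 1))) δ ∩ {h | 0 < h 0}) ≠ ∞ :=
    ne_top_of_le_ne_top measure_ball_lt_top.ne (measure_mono inter_subset_left)
  rw [ENNReal.toReal_mul, ENNReal.toReal_mul] at hratio
  rw [ENNReal.toReal_mul, ENNReal.toReal_mul, ENNReal.toReal_ofReal (by positivity)] at hhalf'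
  rw [← ENNReal.ofReal_toReal hHtop,
    ← ENNReal.ofReal_toReal (measure_ball_lt_top (μ := volume)
      (x := (0 : EuclideanSpace ℝ (Fin m))) (r := 1)).ne,
    ← ENNReal.ofReal_mul ENNReal.toReal_nonneg, ← ENNReal.ofReal_mul (by positivity)]
  refine ENNReal.ofReal_le_ofReal ?_
  have hB := measureReal_unitBall_pos (μH[((m + 1 : ℕ) : ℝ)] : Measure (EuclideanSpace ℝ (Fin (m + 1))))
  set A := (μH[(m : ℝ)] (ball (0 : EuclideanSpace ℝ (Fin m)) 1)).toReal
  set B := (μH[((m + 1 : ℕ) : ℝ)] (ball (0 : EuclideanSpace ℝ (Fin (m + 1))) 1)).toReal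
  set V := (volume (ball (0 : EuclideanSpace ℝ (Fin (m + 1))) δ ∩ {h | 0 < h 0})).toReal
  set α := (volume (ball (0 : EuclideanSpace ℝ (Fin m)) 1)).toReal
  set β := (volume (ball (0 : EuclideanSpace ℝ (Fin (m + 1))) 1)).toReal
  have hA : 0 ≤ A := ENNReal.toReal_nonneg
  rw [ENNReal.toReal_ofNat] at hhalf'
  calc V * (δ * (2 / (m + 2) * (A / B))) = 2 * V * (δ / (m + 2) * (A / B)) := by ring
    _ ≤ δ ^ (m + 1) * β * (δ / (m + 2) * (A / B)) := by gcongr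
    _ = δ ^ (m + 2) / (m + 2) * (A * β / B) := by ring
    _ ≤ δ ^ (m + 2) / (m + 2) * α := by
        gcongr
        rw [div_le_iff₀ hB, mul_comm α]
        exact hratio

/-- A basic nonlocal Poincaré inequality (Example 1.1 / `Ex:BasicEx1`):
for `Ψ(x) = B_δ(x) ∩ {y : (y-x)·e₁ > 0}` and `Γ = closure(⋃_{x∈Ω} Ψ(x)) \ Ω`, any
`u ∈ L¹(ℝⁿ)` vanishing a.e. on `Γ` satisfies
`∫_Ω |u|² ≤ (4(1+diam Ω)³/η²) ∫_Ω |⨍_{Ψ(x)} (u(y)-u(x))/δ dy|² dx`. -/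
theorem stmt0 (n : ℕ) (hn : 1 ≤ n)
    (Ω : Set (EuclideanSpace ℝ (Fin n)))
    (hΩopen : IsOpen Ω) (hΩne : Ω.Nonempty) (hΩbdd : Bornology.IsBounded Ω)
    (δ : ℝ) (hδ0 : 0 < δ) (hδ1 : δ ≤ 1)
    (η : ℝ)
    (hη : η = (2 / ((n : ℝ) + 1)) *
      ((μH[(n : ℝ) - 1] (Metric.ball (0 : EuclideanSpace ℝ (Fin (n - 1))) 1)).toReal /
       (μH[(n : ℝ)] (Metric.ball (0 : EuclideanSpace ℝ (Fin n)) 1)).toReal))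
    (Ψ : EuclideanSpace ℝ (Fin n) → Set (EuclideanSpace ℝ (Fin n)))
    (hΨ : ∀ x, Ψ x = Metric.ball x δ ∩ {y | 0 < (y - x) ⟨0, hn⟩})
    (Γ : Set (EuclideanSpace ℝ (Fin n)))
    (hΓ : Γ = closure (⋃ x ∈ Ω, Ψ x) \ Ω)
    (u : EuclideanSpace ℝ (Fin n) → ℝ)
    (hu : Integrable u)
    (hu0 : ∀ᵐ x, x ∈ Γ → u x = 0) :
    ∫⁻ x in Ω, ENNReal.ofReal (|u x| ^ 2) ≤
      ENNReal.ofReal (4 * (1 + Metric.diam Ω) ^ 3 / η ^ 2) *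
        ∫⁻ x in Ω, ENNReal.ofReal (|⨍ y in Ψ x, (u y - u x) / δ| ^ 2) := by
  obtain ⟨m, rfl⟩ : ∃ m, n = m + 1 := ⟨n - 1, by omega⟩
  set H : Set (EuclideanSpace ℝ (Fin (m + 1))) := ball 0 δ ∩ {h | 0 < h 0} with hHdef
  have hHopen : IsOpen H := isOpen_ball.inter (isOpen_lt (by fun_prop) (by fun_prop))
  have hHne : H.Nonempty := by
    refine ⟨EuclideanSpace.single 0 (δ / 2), ?_, ?_⟩
    · rw [mem_ball_zero_iff, PiLp.norm_single, Real.norm_eq_abs,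
        abs_of_pos (by positivity)]
      linarith
    · simpa using hδ0
  have hcoord : ∀ x : EuclideanSpace ℝ (Fin (m + 1)), |x 0| ≤ ‖x‖ :=
    fun x => PiLp.norm_apply_le x 0
  have hη' : η = 2 / ((m : ℝ) + 2) *
      ((μH[(m : ℝ)] (ball (0 : EuclideanSpace ℝ (Fin m)) 1)).toReal /
        (μH[((m + 1 : ℕ) : ℝ)] (ball (0 : EuclideanSpace ℝ (Fin (m + 1))) 1)).toReal) := by
    have h1 : ((m + 1 : ℕ) : ℝ) - 1 = m := by push_cast; ring
    have h2 : ((m + 1 : ℕ) : ℝ) + 1 = m + 2 := by push_cast; ring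
    rw [h1, h2] at hη
    exact hη
  have hηpos : 0 < η := by
    have := isAddHaarMeasure_hausdorffMeasure_natCast m
    have := isAddHaarMeasure_hausdorffMeasure_natCast (m + 1)
    rw [hη']
    exact mul_pos (by positivity) (div_pos (measureReal_unitBall_pos _) (measureReal_unitBall_pos _))
  have hcoord_diff : ∀ x ∈ Ω, ∀ y ∈ Ω, x 0 - y 0 ≤ diam Ω := fun x hx y hy =>
    (le_abs_self _).trans <| (hcoord (x - y)).trans <| by
      rw [← dist_eq_norm]
      exact dist_le_diam_of_mem hΩbdd hx hy
  set s : Set ℝ := (fun x : EuclideanSpace ℝ (Fin (m + 1)) => x 0) '' Ω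
  have hsbdd : BddBelow s := by
    obtain ⟨z, hz⟩ := hΩne
    refine ⟨z 0 - diam Ω, ?_⟩
    rintro _ ⟨x, hx, rfl⟩
    have := hcoord_diff z hz x hx
    simp only
    linarith
  have hinf_le : ∀ y ∈ Ω, sInf s ≤ y 0 := fun y hy => csInf_le hsbdd ⟨y, hy, rfl⟩
  have hle_inf : ∀ y ∈ Ω, y 0 - diam Ω ≤ sInf s := by
    intro y hy
    refine le_csInf (hΩne.image _) ?_
    rintro _ ⟨x, hx, rfl⟩
    have := hcoord_diff y hy x hx
    simp only
    linarith
  have hΨopen : ∀ x, IsOpen (Ψ x) := fun x => by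
    rw [hΨ]
    exact isOpen_ball.inter (isOpen_lt (by fun_prop) (by fun_prop))
  have hu0' : ∀ x ∈ Ω, ∀ᵐ y ∂volume.restrict (Ψ x), y ∉ Ω → u y = 0 := by
    intro x hx
    filter_upwards [ae_restrict_mem (hΨopen x).measurableSet, ae_restrict_of_ae hu0]
      with y hy hy0 hyΩ
    refine hy0 ?_
    rw [hΓ]
    exact ⟨subset_closure (mem_biUnion hx hy), hyΩ⟩
  have hdiam : 0 ≤ diam Ω := diam_nonneg
  have main := lintegral_sq_le_lintegral_average_diff_sq (μ := volume)
    (EuclideanSpace.proj (0 : Fin (m + 1)) : EuclideanSpace ℝ (Fin (m + 1)) →L[ℝ] ℝ)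
    (sInf s - δ) hΩopen.measurableSet hΩbdd.measure_lt_top.ne hHopen.measurableSet
    (hHopen.measure_pos volume hHne).ne'
    (ne_top_of_le_ne_top measure_ball_lt_top.ne (measure_mono inter_subset_left))
    (fun h hh => le_of_lt hh.2) (M := 1 + diam Ω)
    (fun y hy h hh => by
      have h1 := hinf_le y hy
      have h2 := (le_abs_self _).trans_lt ((hcoord h).trans_lt (mem_ball_zero_iff.1 hh.1))
      change 0 ≤ y 0 - (sInf s - δ) - h 0
      linarith)
    (by positivity) hδ0 hηpos
    (fun y hy => by
      have := hle_inf y hy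
      change y 0 - (sInf s - δ) ≤ 1 + diam Ω
      linarith)
    (by
      rw [hη']
      exact volume_halfBall_mul_le_setLIntegral_coord m hδ0)
    (fun x => (hΨopen x).measurableSet)
    (fun x => by
      ext h
      simp [hΨ, hHdef])
    hu hu0'
  simp only [sq_abs]
  refine main.trans ?_
  gcongr
  · linarith
  · norm_num
end

section
/- Let n ≥ 1, let Ω, Φ ⊂ ℝⁿ be nonempty open bounded sets with countable open partitions {Ω_i}_{i∈I} and {Φ_j}_{j∈J}, and let z : ℝⁿ × Φ → ℝⁿ be measurable with z(x,ζ) = 0 for x ∉ Ω. Define y(x,ζ) := x + z(x,ζ) with iterates y^k, generating for each ζ ∈ Φ the discrete dynamical system D_ζ. Let Ω′ ⊆ Ω be measurable and let U ⊆ ℝⁿ \ Ω′ be open, and suppose U essentially absorbs Ω′ in D_ζ for every ζ ∈ Φ. For α ∈ ℕ set Φ′_α := { ζ ∈ Φ : the absorption index of Ω′ into U in D_ζ equals α }. Assume: (i) z is countably Lipschitz on {Ω_i × Φ_j}_{i∈I, j∈J}; (ii) for each ζ ∈ Φ, x ↦ y(x,ζ) is a Lusin map on Ω and countably injective on {Ω_i}_{i∈I};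 (iii) for a.e. (x,ζ) ∈ Ω × Φ, y(·,ζ) is differentiable at x with det D_x y(x,ζ) ≠ 0. Then Φ′_α is a Borel subset of ℝⁿ for every α ∈ ℕ. -/
open MeasureTheory Metric Set
open scoped ENNReal NNReal

/-- A countable open partition of `E`: countably many pairwise disjoint open subsets of `E`
whose union has full measure in `E`. -/
def IsCountableOpenPartition {X : Type*} [TopologicalSpace X] [MeasureSpace X]
    {I : Type*} (E : Set X) (s : I → Set X) : Prop :=
  (∀ i, IsOpen (s i)) ∧ (∀ i, s i ⊆ E) ∧
    Pairwise (Function.onFun Disjoint s) ∧ volume (E \ ⋃ i, s i) = 0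

/-- `U` absorbs `E` at time `k` under the map `y`: for every `k' ≥ k` the `k'`-th image of
`E` is, up to a null set, contained in a compact subset of `U`. -/
def AbsorbsFrom {X : Type*} [TopologicalSpace X] [MeasureSpace X]
    (y : X → X) (E U : Set X) (k : ℕ) : Prop :=
  ∀ k' ≥ k, ∃ K : Set X, IsCompact K ∧ K ⊆ U ∧ volume (y^[k'] '' E \ K) = 0

/-- `k` is the absorption index of `E` into `U` under `y` (the smallest absorption time). -/
def AbsorptionIndex {X : Type*} [TopologicalSpace X] [MeasureSpace X]
    (y : X → X) (E U : Set X) (k : ℕ) : Prop :=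
  AbsorbsFrom y E U k ∧ ∀ j < k, ¬ AbsorbsFrom y E U j

/-- A map sending null sets to null sets respects almost everywhere equality of sets. -/
theorem image_ae_eq_of_image_null {X : Type*} [MeasurableSpace X] {μ : Measure X} {f : X → X}
    (hf : ∀ T : Set X, μ T = 0 → μ (f '' T) = 0) {s t : Set X} (hst : s =ᵐ[μ] t) :
    f '' s =ᵐ[μ] f '' t := by
  have hdiff (u v : Set X) (h : μ (u \ v) = 0) : μ (f '' u \ f '' v) = 0 := by
    refine measure_mono_null ?_ (hf _ h)
    rintro _ ⟨⟨x, hx, rfl⟩, hv⟩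
    exact ⟨x, ⟨hx, fun hxv => hv ⟨x, hxv, rfl⟩⟩, rfl⟩
  rw [ae_eq_set] at hst ⊢
  exact ⟨hdiff _ _ hst.1, hdiff _ _ hst.2⟩

/-- If a jointly measurable family `y · ζ` is the identity off `Ω`, preserves null sets, and is
injective on countably many pieces exhausting `Ω` up to a null set, then the fibrewise image of a
jointly measurable set is, up to fibrewise null sets, jointly measurable. -/
theorem exists_measurableSet_ae_eq_image {X P I : Type*} [Countable I]
    [MeasurableSpace X] [StandardBorelSpace X] [MeasurableSpace P] [StandardBorelSpace P]
    {μ : Measure X} {y : X → P → X} (hy : Measurable (Function.uncurry y))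
    {Ω : Set X} (hΩ : MeasurableSet Ω) {Φ : Set P} (hΦ : MeasurableSet Φ) {s : I → Set X}
    (hs : ∀ i, MeasurableSet (s i)) (hnull : μ (Ω \ ⋃ i, s i) = 0)
    (hid : ∀ x ∉ Ω, ∀ ζ ∈ Φ, y x ζ = x)
    (hLusin : ∀ ζ ∈ Φ, ∀ T : Set X, μ T = 0 → μ ((y · ζ) '' T) = 0)
    (hinj : ∀ ζ ∈ Φ, ∀ i, InjOn (y · ζ) (s i))
    {B : Set (X × P)} (hB : MeasurableSet B) :
    ∃ C : Set (X × P), MeasurableSet C ∧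
      ∀ ζ ∈ Φ, (y · ζ) '' ((·, ζ) ⁻¹' B) =ᵐ[μ] ((·, ζ) ⁻¹' C : Set X) := by
  set F : X × P → X × P := fun q => (y q.1 q.2, q.2) with hF
  have hFm : Measurable F := hy.prodMk measurable_snd
  refine ⟨(⋃ i, F '' (B ∩ s i ×ˢ Φ)) ∪ B ∩ Ωᶜ ×ˢ Φ, ?_, fun ζ hζ => ?_⟩
  · refine (MeasurableSet.iUnion fun i => ?_).union (hB.inter (hΩ.compl.prod hΦ))
    refine (hB.inter ((hs i).prod hΦ)).image_of_measurable_injOn hFm ?_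
    rintro ⟨a, ζ⟩ ⟨-, ha, hζ⟩ ⟨b, η⟩ ⟨-, hb, -⟩ hab
    simp only [hF, Prod.mk.injEq] at hab
    obtain ⟨hab, rfl⟩ := hab
    exact Prod.ext (hinj ζ hζ i ha hb hab) rfl
  · rw [ae_eq_set]
    constructor
    · refine measure_mono_null ?_ (hLusin ζ hζ _ hnull)
      rintro _ ⟨⟨x, hxB, rfl⟩, hx⟩
      refine ⟨x, ⟨?_, fun hxs => hx ?_⟩, rfl⟩
      · by_contra hxΩ
        refine hx (Or.inr ?_)
        simp only [hid x hxΩ ζ hζ]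
        exact ⟨hxB, hxΩ, hζ⟩
      · obtain ⟨i, hi⟩ := mem_iUnion.1 hxs
        exact Or.inl (mem_iUnion.2 ⟨i, (x, ζ), ⟨hxB, hi, hζ⟩, rfl⟩)
    · rw [sdiff_eq_empty.2, measure_empty]
      rintro x (hx | ⟨hxB, hxΩ, -⟩)
      · obtain ⟨i, ⟨a, η⟩, ⟨haB, -, -⟩, ha⟩ := mem_iUnion.1 hx
        simp only [hF, Prod.mk.injEq] at ha
        obtain ⟨ha, rfl⟩ := ha
        exact ⟨a, haB, ha⟩
      · exact ⟨x, hxB, hid x hxΩ ζ hζ⟩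

/-- In a locally compact, second countable Hausdorff space, if a family of sets is fibrewise
almost everywhere equal to a jointly measurable set, then the parameters for which the set is
essentially contained in a compact subset of an open `U` form a measurable set. -/
theorem measurableSet_essentially_subset_compact {X P : Type*} [TopologicalSpace X] [T2Space X]
    [LocallyCompactSpace X] [SecondCountableTopology X] [MeasurableSpace X] [BorelSpace X]
    [MeasurableSpace P] {μ : Measure X} [SFinite μ] {Φ : Set P} (hΦ : MeasurableSet Φ)
    {A : P → Set X} {B : Set (X × P)} (hB : MeasurableSet B)
    (hAB : ∀ ζ ∈ Φ, A ζ =ᵐ[μ] ((·, ζ) ⁻¹' B : Set X)) {U : Set X} (hU : IsOpen U) :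
    MeasurableSet {ζ ∈ Φ | ∃ K : Set X, IsCompact K ∧ K ⊆ U ∧ μ (A ζ \ K) = 0} := by
  have : LocallyCompactSpace U := hU.locallyCompactSpace
  let e : CompactExhaustion U := default
  let K : ℕ → Set X := fun m => (↑) '' e m
  have hKc : ∀ m, IsCompact (K m) := fun m => (e.isCompact m).image continuous_subtype_val
  have key : {ζ ∈ Φ | ∃ K : Set X, IsCompact K ∧ K ⊆ U ∧ μ (A ζ \ K) = 0} =
      Φ ∩ ⋃ m, {ζ | μ ((·, ζ) ⁻¹' (B \ K m ×ˢ univ)) = 0} := by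
    ext ζ
    simp only [mem_ofPred_eq, mem_inter_iff, mem_iUnion]
    refine and_congr_right fun hζ => ?_
    have hm : ∀ m, μ ((·, ζ) ⁻¹' (B \ K m ×ˢ univ)) = μ (A ζ \ K m) := fun m => by
      have hpre : (·, ζ) ⁻¹' (B \ K m ×ˢ univ) = ((·, ζ) ⁻¹' B : Set X) \ K m := by
        ext; simp
      rw [hpre]
      exact measure_congr ((hAB ζ hζ).symm.diff (ae_eq_refl (K m)))
    simp only [hm]
    constructor
    · rintro ⟨L, hL, hLU, h0⟩
      obtain ⟨m, hLm⟩ := e.exists_superset_of_isCompact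
        (Topology.IsInducing.subtypeVal.isCompact_preimage' hL
          (by rwa [Subtype.range_coe]) : IsCompact ((↑) ⁻¹' L : Set U))
      refine ⟨m, measure_mono_null (sdiff_subset_sdiff_right fun x hx => ?_) h0⟩
      exact ⟨⟨x, hLU hx⟩, hLm hx, rfl⟩
    · rintro ⟨m, h0⟩
      exact ⟨K m, hKc m, Subtype.coe_image_subset U (e m), h0⟩
  rw [key]
  refine hΦ.inter (MeasurableSet.iUnion fun m => ?_)
  exact measurable_measure_prodMk_right
    (hB.diff ((hKc m).measurableSet.prod MeasurableSet.univ)) (measurableSet_singleton 0)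

section

variable (n : ℕ)

local notation "X" => EuclideanSpace ℝ (Fin n)

/-- Borel measurability of the sets of parameters with a given
absorption index (`L:Phi'Measurable`). -/
theorem stmt9 (hn : 1 ≤ n)
    (Ω Φ : Set X)
    (hΩopen : IsOpen Ω) (hΩne : Ω.Nonempty) (hΩbdd : Bornology.IsBounded Ω)
    (hΦopen : IsOpen Φ) (hΦne : Φ.Nonempty) (hΦbdd : Bornology.IsBounded Φ)
    (I J : Type) [Countable I] [Countable J]
    (Ωi : I → Set X) (hpartΩ : IsCountableOpenPartition Ω Ωi)
    (Φj : J → Set X) (hpartΦ : IsCountableOpenPartition Φ Φj)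
    (z : X → X → X) (hzmeas : Measurable (Function.uncurry z))
    (hz0 : ∀ x ∉ Ω, ∀ ζ ∈ Φ, z x ζ = 0)
    (Ω' : Set X) (hΩ'meas : MeasurableSet Ω') (hΩ' : Ω' ⊆ Ω)
    (U : Set X) (hUopen : IsOpen U) (hUΩ' : U ⊆ Ω'ᶜ)
    (habs : ∀ ζ ∈ Φ, ∃ k : ℕ, AbsorptionIndex (fun x => x + z x ζ) Ω' U k)
    -- (i) z is countably Lipschitz on {Ω_i × Φ_j}
    (hzLip : ∀ i j, ∃ K : ℝ≥0, LipschitzOnWith K (Function.uncurry z) (Ωi i ×ˢ Φj j))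
    -- (ii) x ↦ y(x,ζ) is a Lusin map on Ω, countably injective on {Ω_i}
    (hyLusin : ∀ ζ ∈ Φ, ∀ T ⊆ Ω, volume T = 0 → volume ((fun x => x + z x ζ) '' T) = 0)
    (hyInj : ∀ ζ ∈ Φ, ∀ i, Set.InjOn (fun x => x + z x ζ) (Ωi i))
    -- (iii) nonvanishing Jacobian
    (hdet : ∀ᵐ q : X × X, q.1 ∈ Ω → q.2 ∈ Φ →
      ∃ D : X →L[ℝ] X, HasFDerivAt (fun x => x + z x q.2) D q.1 ∧ D.det ≠ 0) :
    ∀ α : ℕ, 0 < α →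
      MeasurableSet {ζ ∈ Φ | AbsorptionIndex (fun x => x + z x ζ) Ω' U α} := by
  set y : X → X → X := fun x ζ => x + z x ζ with hydef
  have hy : Measurable (Function.uncurry y) := measurable_fst.add hzmeas
  have hid : ∀ x ∉ Ω, ∀ ζ ∈ Φ, y x ζ = x := fun x hx ζ hζ => by simp [hydef, hz0 x hx ζ hζ]
  have hLusin : ∀ ζ ∈ Φ, ∀ T : Set X, volume T = 0 → volume ((y · ζ) '' T) = 0 := by
    intro ζ hζ T hT
    refine measure_mono_null ?_ (measure_union_null
      (hyLusin ζ hζ (T ∩ Ω) inter_subset_right (measure_mono_null inter_subset_left hT)) hT)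
    rintro _ ⟨x, hx, rfl⟩
    by_cases hxΩ : x ∈ Ω
    · exact Or.inl ⟨x, ⟨hx, hxΩ⟩, rfl⟩
    · exact Or.inr (by simpa only [hid x hxΩ ζ hζ] using hx)
  have hiter : ∀ k : ℕ, ∃ B : Set (X × X), MeasurableSet B ∧
      ∀ ζ ∈ Φ, (y · ζ)^[k] '' Ω' =ᵐ[volume] ((·, ζ) ⁻¹' B : Set X) := by
    intro k
    induction k with
    | zero => exact ⟨Ω' ×ˢ univ, hΩ'meas.prod MeasurableSet.univ, fun ζ _ => by simpa using ae_eq_refl Ω'⟩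
    | succ k ih =>
      obtain ⟨B, hB, hBk⟩ := ih
      obtain ⟨C, hC, hBC⟩ := exists_measurableSet_ae_eq_image hy hΩopen.measurableSet
        hΦopen.measurableSet (fun i => (hpartΩ.1 i).measurableSet) hpartΩ.2.2.2
        hid hLusin hyInj hB
      refine ⟨C, hC, fun ζ hζ => ?_⟩
      rw [Function.iterate_succ', image_comp]
      exact (image_ae_eq_of_image_null (hLusin ζ hζ) (hBk ζ hζ)).trans (hBC ζ hζ)
  have hstep : ∀ k : ℕ, MeasurableSet {ζ ∈ Φ | ∃ K : Set X, IsCompact K ∧ K ⊆ U ∧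
      volume ((y · ζ)^[k] '' Ω' \ K) = 0} := fun k => by
    obtain ⟨B, hB, hBk⟩ := hiter k
    exact measurableSet_essentially_subset_compact hΦopen.measurableSet hB hBk hUopen
  have hfrom : ∀ k : ℕ, MeasurableSet {ζ ∈ Φ | AbsorbsFrom (y · ζ) Ω' U k} := fun k => by
    have h : {ζ ∈ Φ | AbsorbsFrom (y · ζ) Ω' U k} = Φ ∩ ⋂ k' ≥ k,
        {ζ ∈ Φ | ∃ K : Set X, IsCompact K ∧ K ⊆ U ∧ volume ((y · ζ)^[k'] '' Ω' \ K) = 0} := by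
      ext ζ
      simp only [AbsorbsFrom, mem_ofPred_eq, mem_inter_iff, mem_iInter]
      exact and_congr_right fun hζ => forall₂_congr fun _ _ => (and_iff_right hζ).symm
    rw [h]
    exact hΦopen.measurableSet.inter
      (MeasurableSet.iInter fun k' => MeasurableSet.iInter fun _ => hstep k')
  intro α _
  have h : {ζ ∈ Φ | AbsorptionIndex (y · ζ) Ω' U α} = {ζ ∈ Φ | AbsorbsFrom (y · ζ) Ω' U α} \
      ⋃ j < α, {ζ ∈ Φ | AbsorbsFrom (y · ζ) Ω' U j} := by
    ext ζ
    simp only [AbsorptionIndex, mem_ofPred_eq, mem_sdiff, mem_iUnion]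
    grind
  change MeasurableSet {ζ ∈ Φ | AbsorptionIndex (y · ζ) Ω' U α}
  rw [h]
  exact (hfrom α).diff (MeasurableSet.iUnion fun j => MeasurableSet.iUnion fun _ => hfrom j)

end
end

section
/- Let n ≥ 1, 1 ≤ p < ∞, let Ω ⊂ ℝⁿ be a nonempty open bounded set, let 0 < δ ≤ 1, and set η := (2/(n+1))·(ℋ^{n−1}(B₁^{n−1})/ℋⁿ(B₁ⁿ)). Let Ψ : Ω ⇉ ℝⁿ be a correspondence such that: Ψ and Ψ⁻¹ are measurable-valued, the graph {(x,y) : y ∈ Ψ(x)} is measurable, and x ↦ |Ψ(x)| is measurable and nonnegative; Ψ(x) ⊆ B_δ(x) ∩ {y : (y−x)·e₁ > 0} for each x ∈ Ω; and |Ψ(x)| ≥ (τ/2)|B_δ| for all x ∈ Ω, where 1 − ηδ/(1+diam Ω) < τ ≤ 1. Set ν_τ := (1/τ)·(1 − ηδ/(1+diam Ω)) and Γ := closure( (⋃_{x∈Ω} Ψ(x)) \ Ω ). If u ∈ L¹(ℝⁿ) satisfies u = 0 a.e. on Γ, then ∫_Ω |u(x)|^p dx ≤ C(ν_τ, p)·(1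 + diam Ω)·∫_Ω | ⨍_{Ψ(x)} (u(y) − u(x)) dy |^p dx. -/
open MeasureTheory Metric Set
open scoped ENNReal NNReal

/-- The Poincaré constant `C(ν,p)`: `1/(1-ν)` for `p = 1`, and
`min{ (λ/(1-λ))^{p-1}/(λ^{p-1}-ν) : ν^{1/(p-1)} < λ < 1 }` for `p > 1`. -/
noncomputable def poincareC (ν p : ℝ) : ℝ :=
  if p = 1 then 1 / (1 - ν)
  else sInf ((fun l => (l / (1 - l)) ^ (p - 1) / (l ^ (p - 1) - ν)) ''
    {l : ℝ | ν ^ (1 / (p - 1)) < l ∧ l < 1})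

lemma hausdorffMeasure_le_of_lipschitz_section {X Y : Type*} [MetricSpace X] [MeasurableSpace X]
    [BorelSpace X] [MetricSpace Y] [MeasurableSpace Y] [BorelSpace Y] {d : ℝ} (hd : 0 ≤ d)
    {f : X → ℝ} (hf : LipschitzWith 1 f) {q : X → Y} (hq : LipschitzWith 1 q)
    {A : Set X} {s : Set Y} (hA : ∀ t ∈ Ioo (0 : ℝ) 1, ∀ y ∈ s, ∃ x ∈ A, f x = t ∧ q x = y) :
    μH[d] s ≤ μH[d + 1] A := by
  rw [Measure.hausdorffMeasure_apply, Measure.hausdorffMeasure_apply]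
  refine iSup₂_mono fun r _ => le_iInf₂ fun T hT => le_iInf fun hTr => ?_
  set h := ⨅ (t : ℕ → Set Y) (_ : s ⊆ ⋃ n, t n) (_ : ∀ n, ediam (t n) ≤ r),
    ∑' n, ⨆ _ : (t n).Nonempty, ediam (t n) ^ d with hh
  let g : ℕ → ℝ → ℝ≥0∞ := fun n =>
    (toMeasurable volume (f '' T n)).indicator fun _ => ediam (T n) ^ d
  have hslice : ∀ t ∈ Ioo (0 : ℝ) 1, h ≤ ∑' n, g n t := by
    intro t ht
    refine iInf₂_le_of_le (fun n => q '' (T n ∩ f ⁻¹' {t})) ?_ (iInf_le_of_le ?_ ?_)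
    · intro y hy
      obtain ⟨x, hxA, hxt, rfl⟩ := hA t ht y hy
      obtain ⟨n, hn⟩ := mem_iUnion.1 (hT hxA)
      exact mem_iUnion.2 ⟨n, x, ⟨hn, hxt⟩, rfl⟩
    · intro n
      refine (hq.ediam_image_le _).trans ?_
      rw [ENNReal.coe_one, one_mul]
      exact (ediam_mono inter_subset_left).trans (hTr n)
    · refine ENNReal.tsum_le_tsum fun n => iSup_le fun hne => ?_
      obtain ⟨_, x, ⟨hx, hxt⟩, rfl⟩ := hne
      have hmem : t ∈ toMeasurable volume (f '' T n) :=
        subset_toMeasurable _ _ ⟨x, hx, hxt⟩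
      simp only [g, indicator_of_mem hmem]
      refine ENNReal.rpow_le_rpow ((hq.ediam_image_le _).trans ?_) hd
      rw [ENNReal.coe_one, one_mul]
      exact ediam_mono inter_subset_left
  calc h = ∫⁻ _ in Ioo (0 : ℝ) 1, h := by simp
    _ ≤ ∫⁻ t in Ioo (0 : ℝ) 1, ∑' n, g n t := setLIntegral_mono' measurableSet_Ioo hslice
    _ ≤ ∫⁻ t, ∑' n, g n t := setLIntegral_le_lintegral _ _
    _ = ∑' n, ∫⁻ t, g n t := lintegral_tsum fun n =>
      (measurable_const.indicator (measurableSet_toMeasurable _ _)).aemeasurable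
    _ ≤ _ := by
      refine ENNReal.tsum_le_tsum fun n => ?_
      rw [lintegral_indicator_const (measurableSet_toMeasurable _ _), measure_toMeasurable]
      rcases (T n).eq_empty_or_nonempty with h0 | hne
      · simp [h0]
      · refine le_iSup_of_le hne ?_
        rw [ENNReal.rpow_add_of_nonneg _ _ hd zero_le_one, ENNReal.rpow_one]
        gcongr
        refine (Real.volume_le_diam _).trans ((hf.ediam_image_le _).trans ?_)
        rw [ENNReal.coe_one, one_mul]

/-- The coordinates of a vector other than the first. -/
noncomputable def euclideanTail {m : ℕ} (x : EuclideanSpace ℝ (Fin (m + 1))) :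
    EuclideanSpace ℝ (Fin m) :=
  WithLp.toLp 2 fun i => x i.succ

lemma norm_sq_eq_add_tail {m : ℕ} (x : EuclideanSpace ℝ (Fin (m + 1))) :
    ‖x‖ ^ 2 = x 0 ^ 2 + ‖euclideanTail x‖ ^ 2 := by
  simp [EuclideanSpace.norm_sq_eq, Fin.sum_univ_succ, euclideanTail]

lemma lipschitzWith_euclideanTail {m : ℕ} :
    LipschitzWith 1 (euclideanTail : EuclideanSpace ℝ (Fin (m + 1)) → _) := by
  refine LipschitzWith.of_dist_le_mul fun x y => ?_
  rw [NNReal.coe_one, one_mul, dist_eq_norm, dist_eq_norm]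
  have h : euclideanTail x - euclideanTail y = euclideanTail (x - y) := rfl
  rw [h]
  refine abs_le_of_sq_le_sq' ?_ (norm_nonneg _) |>.2
  rw [norm_sq_eq_add_tail (x - y)]
  nlinarith [sq_nonneg ((x - y) 0)]

lemma abs_coord_le_norm {n : ℕ} (x : EuclideanSpace ℝ (Fin n)) (i : Fin n) : |x i| ≤ ‖x‖ := by
  simpa using PiLp.norm_apply_le x i

lemma lipschitzWith_coord {n : ℕ} (i : Fin n) :
    LipschitzWith 1 fun x : EuclideanSpace ℝ (Fin n) => x i :=
  LipschitzWith.of_dist_le_mul fun x y => by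
    simpa [dist_eq_norm] using abs_coord_le_norm (x - y) i

lemma measurePreserving_coord_tail (m : ℕ) :
    MeasurePreserving (fun x : EuclideanSpace ℝ (Fin (m + 1)) => (x 0, euclideanTail x)) := by
  have h1 := EuclideanSpace.volume_preserving_symm_measurableEquiv_toLp (Fin (m + 1))
  have h2 := volume_preserving_piFinSuccAbove (fun _ : Fin (m + 1) => ℝ) 0
  have h3 := (MeasurePreserving.id (volume : Measure ℝ)).prod
    (EuclideanSpace.volume_preserving_symm_measurableEquiv_toLp (Fin m)).symm
  exact h3.comp (h2.comp h1)

lemma exists_hausdorffMeasure_eq_smul_volume (n : ℕ) : ∃ c : ℝ≥0∞, c ≠ 0 ∧ c ≠ ∞ ∧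
    (μH[(n : ℝ)] : Measure (EuclideanSpace ℝ (Fin n))) = c • volume := by
  have hH : Measure.IsAddHaarMeasure (μH[(n : ℝ)] : Measure (EuclideanSpace ℝ (Fin n))) := by
    simpa using isAddHaarMeasure_hausdorffMeasure (E := EuclideanSpace ℝ (Fin n))
  have h := Measure.isAddLeftInvariant_eq_smul
    (μH[(n : ℝ)] : Measure (EuclideanSpace ℝ (Fin n))) volume
  refine ⟨_, ?_, ENNReal.coe_ne_top, h⟩
  exact ENNReal.coe_ne_zero.2 (Measure.addHaarScalarFactor_pos_of_isAddHaarMeasure _ _).ne'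

lemma hausdorffMeasure_ball_ratio_le (m : ℕ) :
    (μH[(m : ℝ)] (ball (0 : EuclideanSpace ℝ (Fin m)) 1)).toReal /
      (μH[(m : ℝ) + 1] (ball (0 : EuclideanSpace ℝ (Fin (m + 1))) 1)).toReal ≤
    (volume (ball (0 : EuclideanSpace ℝ (Fin m)) 1)).toReal /
      (volume (ball (0 : EuclideanSpace ℝ (Fin (m + 1))) 1)).toReal := by
  obtain ⟨c, hc0, hct, hc⟩ := exists_hausdorffMeasure_eq_smul_volume m
  obtain ⟨c', hc0', hct', hc'⟩ := exists_hausdorffMeasure_eq_smul_volume (m + 1)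
  push_cast at hc'
  have hω : 0 < volume (ball (0 : EuclideanSpace ℝ (Fin m)) 1) := measure_ball_pos _ _ one_pos
  have hω' : 0 < volume (ball (0 : EuclideanSpace ℝ (Fin (m + 1))) 1) :=
    measure_ball_pos _ _ one_pos
  have hωt : volume (ball (0 : EuclideanSpace ℝ (Fin m)) 1) ≠ ∞ := measure_ball_lt_top.ne
  have hωt' : volume (ball (0 : EuclideanSpace ℝ (Fin (m + 1))) 1) ≠ ∞ := measure_ball_lt_top.ne
  have hvol : volume ((fun x : EuclideanSpace ℝ (Fin (m + 1)) => (x 0, euclideanTail x)) ⁻¹'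
      (Ioo 0 1 ×ˢ ball 0 1)) = volume (ball (0 : EuclideanSpace ℝ (Fin m)) 1) := by
    rw [(measurePreserving_coord_tail m).measure_preimage
      (measurableSet_Ioo.prod measurableSet_ball).nullMeasurableSet, Measure.volume_eq_prod,
      Measure.prod_prod]
    simp
  have hle := hausdorffMeasure_le_of_lipschitz_section (d := (m : ℝ)) m.cast_nonneg
    (lipschitzWith_coord (0 : Fin (m + 1))) lipschitzWith_euclideanTail
    (A := (fun x : EuclideanSpace ℝ (Fin (m + 1)) => (x 0, euclideanTail x)) ⁻¹'
      (Ioo 0 1 ×ˢ ball 0 1)) (s := ball 0 1) (by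
      intro t ht y hy
      have hy' : euclideanTail (WithLp.toLp 2 (Fin.cons t y)) = y := by
        ext i; simp [euclideanTail]
      exact ⟨WithLp.toLp 2 (Fin.cons t y), ⟨by simpa using ht, by simpa only [hy'] using hy⟩,
        by simp, hy'⟩)
  rw [hc, hc', Measure.smul_apply, Measure.smul_apply, hvol, smul_eq_mul, smul_eq_mul,
    ENNReal.mul_le_mul_iff_left hω.ne' hωt] at hle
  rw [hc, hc', Measure.smul_apply, Measure.smul_apply, smul_eq_mul, smul_eq_mul,
    ENNReal.toReal_mul, ENNReal.toReal_mul]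
  have h1 := ENNReal.toReal_pos hω'.ne' hωt'
  have h2 := ENNReal.toReal_pos hc0' hct'
  have h3 := ENNReal.toReal_mono hct' hle
  rw [div_le_div_iff₀ (by positivity) h1]
  have h4 : (0 : ℝ) ≤ (volume (ball (0 : EuclideanSpace ℝ (Fin m)) 1)).toReal *
    (volume (ball (0 : EuclideanSpace ℝ (Fin (m + 1))) 1)).toReal := by positivity
  nlinarith

lemma integral_mul_sqrt_pow (m : ℕ) {r : ℝ} (hr : 0 < r) :
    ∫ t in (0 : ℝ)..r, t * √(r ^ 2 - t ^ 2) ^ m = r ^ (m + 2) / (m + 2) := by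
  have h := intervalIntegral.integral_eq_sub_of_hasDerivAt_of_le (a := 0) (b := r) hr.le
    (f := fun t => -(√(r ^ 2 - t ^ 2) ^ (m + 2) / (m + 2)))
    (f' := fun t => t * √(r ^ 2 - t ^ 2) ^ m) (by fun_prop) (by
      intro t ht
      have hpos : 0 < r ^ 2 - t ^ 2 := by nlinarith [ht.1, ht.2]
      have hs := Real.sqrt_pos.2 hpos
      have hd : HasDerivAt (fun t : ℝ => r ^ 2 - t ^ 2) (-(2 * t)) t := by
        simpa using (hasDerivAt_pow 2 t).const_sub (r ^ 2)
      convert! (((hd.sqrt hpos.ne').pow (m + 2)).div_const ((m : ℝ) + 2)).neg using 1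
      have : (m : ℝ) + 2 ≠ 0 := by positivity
      push_cast
      field_simp
      ring)
    (Continuous.intervalIntegrable (by fun_prop) _ _)
  rw [h]
  simp [Real.sqrt_sq hr.le]

lemma lintegral_coord_half_ball (m : ℕ) {r : ℝ} (hr : 0 < r) :
    ∫⁻ z in ball (0 : EuclideanSpace ℝ (Fin (m + 1))) r ∩ {z | 0 < z 0}, ENNReal.ofReal (z 0) =
      ENNReal.ofReal (r ^ (m + 2) / (m + 2)) *
        volume (ball (0 : EuclideanSpace ℝ (Fin m)) 1) := by
  set S : Set (ℝ × EuclideanSpace ℝ (Fin m)) := {q | 0 < q.1 ∧ q.1 ^ 2 + ‖q.2‖ ^ 2 < r ^ 2} with hS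
  have hSm : MeasurableSet S := by
    refine (measurableSet_lt measurable_const measurable_fst).inter
      (measurableSet_lt (f := fun q : ℝ × EuclideanSpace ℝ (Fin m) => q.1 ^ 2 + ‖q.2‖ ^ 2)
        (by fun_prop) measurable_const)
  have hpre : ball (0 : EuclideanSpace ℝ (Fin (m + 1))) r ∩ {z | 0 < z 0} =
      (fun x : EuclideanSpace ℝ (Fin (m + 1)) => (x 0, euclideanTail x)) ⁻¹' S := by
    ext z
    simp only [mem_inter_iff, mem_ball_zero_iff, mem_ofPred_eq, mem_preimage, hS,
      ← norm_sq_eq_add_tail, sq_lt_sq₀ (norm_nonneg z) hr.le]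
    tauto
  have hslice : ∀ t : ℝ, ∫⁻ v, S.indicator (fun q => ENNReal.ofReal q.1) (t, v) =
      (Ioo 0 r).indicator (fun t => ENNReal.ofReal (t * √(r ^ 2 - t ^ 2) ^ m) *
        volume (ball (0 : EuclideanSpace ℝ (Fin m)) 1)) t := by
    intro t
    by_cases ht : t ∈ Ioo 0 r
    · have hpos : 0 < r ^ 2 - t ^ 2 := by nlinarith [ht.1, ht.2]
      rw [indicator_of_mem ht]
      have : (fun v => S.indicator (fun q => ENNReal.ofReal q.1) (t, v)) =
          (ball (0 : EuclideanSpace ℝ (Fin m)) √(r ^ 2 - t ^ 2)).indicator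
            fun _ => ENNReal.ofReal t := by
        ext v
        have : (t, v) ∈ S ↔ v ∈ ball (0 : EuclideanSpace ℝ (Fin m)) √(r ^ 2 - t ^ 2) := by
          rw [mem_ball_zero_iff, Real.lt_sqrt (norm_nonneg _)]
          simp only [hS, mem_ofPred_eq, ht.1, true_and]
          constructor <;> intro h <;> linarith
        by_cases hv : v ∈ ball (0 : EuclideanSpace ℝ (Fin m)) √(r ^ 2 - t ^ 2)
        · rw [indicator_of_mem (this.2 hv), indicator_of_mem hv]
        · rw [indicator_of_notMem (mt this.1 hv), indicator_of_notMem hv]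
      rw [this, lintegral_indicator_const measurableSet_ball,
        Measure.addHaar_ball_of_pos _ _ (Real.sqrt_pos.2 hpos), finrank_euclideanSpace_fin, ← mul_assoc,
        ENNReal.ofReal_mul ht.1.le]
    · rw [indicator_of_notMem ht]
      have : ∀ v, S.indicator (fun q => ENNReal.ofReal q.1) (t, v) = 0 := by
        intro v
        refine indicator_of_notMem (fun h => ht ⟨h.1, ?_⟩) _
        have := h.2
        simp only at this
        nlinarith [sq_nonneg ‖v‖, h.1]
      simp [this]
  have hmeas : Measurable (S.indicator fun q => ENNReal.ofReal q.1) :=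
    (by fun_prop : Measurable fun q : ℝ × EuclideanSpace ℝ (Fin m) =>
      ENNReal.ofReal q.1).indicator hSm
  calc _ = ∫⁻ z : EuclideanSpace ℝ (Fin (m + 1)),
        S.indicator (fun q => ENNReal.ofReal q.1) (z 0, euclideanTail z) := by
        rw [hpre, ← lintegral_indicator ((measurePreserving_coord_tail m).measurable hSm)]
        rfl
    _ = ∫⁻ q, S.indicator (fun q => ENNReal.ofReal q.1) q :=
        (measurePreserving_coord_tail m).lintegral_comp hmeas
    _ = ∫⁻ t in Ioo 0 r, ENNReal.ofReal (t * √(r ^ 2 - t ^ 2) ^ m) *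
        volume (ball (0 : EuclideanSpace ℝ (Fin m)) 1) := by
        rw [Measure.volume_eq_prod, lintegral_prod _ hmeas.aemeasurable]
        simp_rw [hslice]
        rw [lintegral_indicator measurableSet_Ioo]
    _ = _ := by
        rw [lintegral_mul_const _ (by fun_prop), ← integral_mul_sqrt_pow m hr,
          intervalIntegral.integral_of_le hr.le, integral_Ioc_eq_integral_Ioo,
          ofReal_integral_eq_lintegral_ofReal]
        · exact (Continuous.integrableOn_Icc (by fun_prop)).mono_set Ioo_subset_Icc_self
        · filter_upwards [ae_restrict_mem measurableSet_Ioo] with t ht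
          exact mul_nonneg ht.1.le (by positivity)

lemma two_mul_volume_half_ball_le (m : ℕ) (r : ℝ) :
    2 * volume (ball (0 : EuclideanSpace ℝ (Fin (m + 1))) r ∩ {z | 0 < z 0}) ≤
      volume (ball (0 : EuclideanSpace ℝ (Fin (m + 1))) r) := by
  set H := ball (0 : EuclideanSpace ℝ (Fin (m + 1))) r ∩ {z | 0 < z 0} with hH
  have hHm : MeasurableSet H :=
    measurableSet_ball.inter (measurableSet_lt measurable_const (by fun_prop))
  have hneg : volume (-H) = volume H := Measure.measure_neg _ _
  rw [two_mul]
  nth_rewrite 1 [← hneg]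
  rw [← measure_union _ hHm]
  · refine measure_mono (union_subset (fun z hz => ?_) inter_subset_left)
    have := hz.1
    simpa using this
  · refine disjoint_left.2 fun z hz hz' => ?_
    have h1 := hz.2
    have h2 := hz'.2
    simp only [mem_ofPred_eq, PiLp.neg_apply] at h1 h2
    linarith

/-- The first moment of a half ball, in the form of an upper bound for the integral over it of
an affine function decreasing along the axis. -/
lemma lintegral_sub_coord_half_ball_add_le (m : ℕ) {r : ℝ} (hr : 0 < r) {η W : ℝ}
    (hη : η ≤ 2 / ((m : ℝ) + 2) * ((volume (ball (0 : EuclideanSpace ℝ (Fin m)) 1)).toReal /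
      (volume (ball (0 : EuclideanSpace ℝ (Fin (m + 1))) 1)).toReal)) (hη0 : 0 ≤ η) (hW : r ≤ W) :
    (∫⁻ z in ball (0 : EuclideanSpace ℝ (Fin (m + 1))) r ∩ {z | 0 < z 0},
      ENNReal.ofReal (W - z 0)) +
      ENNReal.ofReal (η * r / 2) * volume (ball (0 : EuclideanSpace ℝ (Fin (m + 1))) r) ≤
    ENNReal.ofReal (W / 2) * volume (ball (0 : EuclideanSpace ℝ (Fin (m + 1))) r) := by
  set H := ball (0 : EuclideanSpace ℝ (Fin (m + 1))) r ∩ {z | 0 < z 0} with hH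
  have hHm : MeasurableSet H :=
    measurableSet_ball.inter (measurableSet_lt measurable_const (by fun_prop))
  have hmom : ENNReal.ofReal (η * r / 2) * volume (ball (0 : EuclideanSpace ℝ (Fin (m + 1))) r) ≤
      ∫⁻ z in H, ENNReal.ofReal (z 0) := by
    rw [lintegral_coord_half_ball m hr, Measure.addHaar_ball _ _ hr.le,
      finrank_euclideanSpace_fin]
    have hωt : volume (ball (0 : EuclideanSpace ℝ (Fin m)) 1) ≠ ∞ := measure_ball_lt_top.ne
    have hωt' : volume (ball (0 : EuclideanSpace ℝ (Fin (m + 1))) 1) ≠ ∞ := measure_ball_lt_top.ne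
    have hω' : 0 < (volume (ball (0 : EuclideanSpace ℝ (Fin (m + 1))) 1)).toReal :=
      ENNReal.toReal_pos (measure_ball_pos _ _ one_pos).ne' hωt'
    rw [← ENNReal.ofReal_toReal hωt, ← ENNReal.ofReal_toReal hωt',
      ← ENNReal.ofReal_mul (by positivity), ← ENNReal.ofReal_mul (by positivity),
      ← ENNReal.ofReal_mul (by positivity)]
    refine ENNReal.ofReal_le_ofReal ?_
    set a := (volume (ball (0 : EuclideanSpace ℝ (Fin m)) 1)).toReal
    set b := (volume (ball (0 : EuclideanSpace ℝ (Fin (m + 1))) 1)).toReal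
    calc η * r / 2 * (r ^ (m + 1) * b) ≤ (2 / ((m : ℝ) + 2) * (a / b)) * r / 2 *
          (r ^ (m + 1) * b) := by gcongr
      _ = _ := by field_simp; ring
  calc _ ≤ (∫⁻ z in H, ENNReal.ofReal (W - z 0)) + ∫⁻ z in H, ENNReal.ofReal (z 0) := by gcongr
    _ = ∫⁻ z in H, ENNReal.ofReal W := by
      rw [← lintegral_add_left (by fun_prop)]
      refine setLIntegral_congr_fun hHm fun z hz => ?_
      have h1 := (abs_le.1 (abs_coord_le_norm z 0)).2
      have h2 := mem_ball_zero_iff.1 hz.1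
      simp only
      rw [← ENNReal.ofReal_add (by linarith) (le_of_lt hz.2)]
      congr 1
      ring
    _ = ENNReal.ofReal (W / 2) * (2 * volume H) := by
      rw [lintegral_const, Measure.restrict_apply_univ, ← mul_assoc]
      congr 1
      rw [← ENNReal.ofReal_ofNat 2, ← ENNReal.ofReal_mul (by linarith)]
      congr 1
      ring
    _ ≤ _ := by gcongr; exact two_mul_volume_half_ball_le m r

lemma add_rpow_le_of_mem_Ioo {p l : ℝ} (hp : 1 ≤ p) (hl0 : 0 < l) (hl1 : l < 1) (a b : ℝ≥0∞) :
    (a + b) ^ p ≤ ENNReal.ofReal (l ^ (1 - p)) * a ^ p +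
      ENNReal.ofReal ((1 - l) ^ (1 - p)) * b ^ p := by
  have key : ∀ {t : ℝ}, 0 < t → ∀ c : ℝ≥0∞, ENNReal.ofReal t * (c / ENNReal.ofReal t) = c ∧
      ENNReal.ofReal t * (c / ENNReal.ofReal t) ^ p = ENNReal.ofReal (t ^ (1 - p)) * c ^ p := by
    intro t ht c
    have h0 : ENNReal.ofReal t ≠ 0 := (ENNReal.ofReal_pos.2 ht).ne'
    refine ⟨ENNReal.mul_div_cancel h0 ENNReal.ofReal_ne_top, ?_⟩
    rw [ENNReal.div_rpow_of_nonneg _ _ (by linarith), ← ENNReal.ofReal_rpow_of_pos ht,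
      ENNReal.rpow_sub _ _ h0 ENNReal.ofReal_ne_top, ENNReal.rpow_one]
    simp only [div_eq_mul_inv]
    ring
  have h := ENNReal.rpow_arith_mean_le_arith_mean2_rpow (ENNReal.ofReal l)
    (ENNReal.ofReal (1 - l)) (a / ENNReal.ofReal l) (b / ENNReal.ofReal (1 - l))
    (by rw [← ENNReal.ofReal_add hl0.le (by linarith)]; simp) hp
  rwa [(key hl0 a).1, (key hl0 a).2, (key (sub_pos.2 hl1) b).1, (key (sub_pos.2 hl1) b).2] at h

lemma enorm_average_rpow_le {X : Type*} [MeasurableSpace X] {μ : Measure X} [IsFiniteMeasure μ]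
    [NeZero μ] {p : ℝ} (hp : 1 ≤ p) {u : X → ℝ} (hu : AEStronglyMeasurable u μ) :
    ‖⨍ y, u y ∂μ‖ₑ ^ p ≤ (μ univ)⁻¹ * ∫⁻ y, ‖u y‖ₑ ^ p ∂μ := by
  have hp0 : 0 < p := by linarith
  have hu' : AEStronglyMeasurable u ((μ univ)⁻¹ • μ) := hu.smul_measure _
  have h := eLpNorm_le_eLpNorm_of_exponent_le (p := 1) (q := ENNReal.ofReal p)
    (by simpa using hp) hu'
  rw [eLpNorm_one_eq_lintegral_enorm, eLpNorm_eq_lintegral_rpow_enorm_toReal (by simpa using hp0)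
    ENNReal.ofReal_ne_top, ENNReal.toReal_ofReal hp0.le] at h
  have h2 := ENNReal.rpow_le_rpow ((enorm_integral_le_lintegral_enorm u).trans h) hp0.le
  rw [← ENNReal.rpow_mul, one_div_mul_cancel hp0.ne', ENNReal.rpow_one,
    lintegral_smul_measure] at h2
  exact h2

lemma enorm_rpow_le_average_add {X : Type*} [MeasurableSpace X] {μ : Measure X}
    [IsFiniteMeasure μ] [NeZero μ] {p l : ℝ} (hp : 1 ≤ p) (hl0 : 0 < l) (hl1 : l < 1)
    {u : X → ℝ} (hu : Integrable u μ) (c : ℝ) :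
    ‖c‖ₑ ^ p ≤ ENNReal.ofReal (l ^ (1 - p)) * ‖⨍ y, u y ∂μ‖ₑ ^ p +
      ENNReal.ofReal ((1 - l) ^ (1 - p)) * ‖⨍ y, (u y - c) ∂μ‖ₑ ^ p := by
  refine le_trans ?_ (add_rpow_le_of_mem_Ioo hp hl0 hl1 _ _)
  refine ENNReal.rpow_le_rpow ?_ (by linarith)
  have h : ⨍ y, (u y - c) ∂μ = ⨍ y, u y ∂μ - c := by
    rw [average_eq, integral_sub hu (integrable_const c), smul_sub, ← average_eq, ← average_eq,
      average_const]
  have hc : c = ⨍ y, u y ∂μ - ⨍ y, (u y - c) ∂μ := by rw [h]; ring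
  conv_lhs => rw [hc]
  exact enorm_sub_le

/-- An abstract nonlocal Poincaré inequality: a weight `w` that is contracted by averaging over
the inverse correspondence controls `u` by its nonlocal gradient. -/
lemma lintegral_rpow_le_of_weight {X : Type*} [MeasurableSpace X] {μ : Measure X} [SFinite μ]
    {p l : ℝ} (hp : 1 ≤ p) (hl0 : 0 < l) (hl1 : l < 1) {Ω : Set X} (hΩ : MeasurableSet Ω)
    (hμΩ : μ Ω ≠ ∞) {Ψ : X → Set X} (hΨ : ∀ x ∈ Ω, MeasurableSet (Ψ x))
    (hΨinv : ∀ y, MeasurableSet {x ∈ Ω | y ∈ Ψ x})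
    (hgraph : MeasurableSet {q : X × X | q.1 ∈ Ω ∧ q.2 ∈ Ψ q.1})
    {κ : ℝ≥0∞} (hκ0 : κ ≠ 0) (hκt : κ ≠ ∞) (hκ : ∀ x ∈ Ω, κ ≤ μ (Ψ x))
    (hΨfin : ∀ x ∈ Ω, μ (Ψ x) ≠ ∞) {w : X → ℝ≥0∞} (hw : Measurable w) {D : ℝ≥0∞}
    (hD0 : D ≠ 0) (hDt : D ≠ ∞) (hw1 : ∀ x ∈ Ω, 1 ≤ w x) (hwD : ∀ x ∈ Ω, w x ≤ D) {ν : ℝ≥0∞}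
    (hν : ∀ y ∈ Ω, ∫⁻ x in {x ∈ Ω | y ∈ Ψ x}, w x ∂μ ≤ κ * (ν * w y))
    {u : X → ℝ} (hu : Integrable u μ)
    (hu0 : ∀ᵐ y ∂μ, y ∉ Ω → (∃ x ∈ Ω, y ∈ Ψ x) → u y = 0) :
    (1 - ENNReal.ofReal (l ^ (1 - p)) * ν) * ∫⁻ x in Ω, ‖u x‖ₑ ^ p ∂μ ≤
      ENNReal.ofReal ((1 - l) ^ (1 - p)) *
        (D * ∫⁻ x in Ω, ‖⨍ y in Ψ x, (u y - u x) ∂μ‖ₑ ^ p ∂μ) := by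
  have hp0 : 0 < p := by linarith
  set L₁ := ENNReal.ofReal (l ^ (1 - p)) with hL₁
  set L₂ := ENNReal.ofReal ((1 - l) ^ (1 - p)) with hL₂
  set I := ∫⁻ x in Ω, ‖⨍ y in Ψ x, (u y - u x) ∂μ‖ₑ ^ p ∂μ with hI
  have hL₂0 : L₂ ≠ 0 := (ENNReal.ofReal_pos.2 (Real.rpow_pos_of_pos (sub_pos.2 hl1) _)).ne'
  by_cases hItop : I = ∞
  · rw [hItop, ENNReal.mul_top hD0, ENNReal.mul_top hL₂0]
    exact le_top
  have hpt : ∀ x ∈ Ω, ‖u x‖ₑ ^ p ≤ L₁ * ‖⨍ y in Ψ x, u y ∂μ‖ₑ ^ p +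
      L₂ * ‖⨍ y in Ψ x, (u y - u x) ∂μ‖ₑ ^ p ∧ ∀ {q : ℝ}, 1 ≤ q →
      ‖⨍ y in Ψ x, u y ∂μ‖ₑ ^ q ≤ κ⁻¹ * ∫⁻ y in Ψ x, ‖u y‖ₑ ^ q ∂μ := by
    intro x hx
    have : IsFiniteMeasure (μ.restrict (Ψ x)) :=
      isFiniteMeasure_restrict.2 (hΨfin x hx)
    have : NeZero (μ.restrict (Ψ x)) := ⟨by
      rw [Ne, Measure.restrict_eq_zero]
      exact ((pos_iff_ne_zero.2 hκ0).trans_le (hκ x hx)).ne'⟩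
    refine ⟨enorm_rpow_le_average_add hp hl0 hl1 hu.restrict _, fun hq => ?_⟩
    refine (enorm_average_rpow_le hq hu.restrict.1).trans ?_
    gcongr
    rw [Measure.restrict_apply_univ]
    exact hκ x hx
  have hafin : ∫⁻ x in Ω, ‖u x‖ₑ ^ p ∂μ ≠ ∞ := by
    have hC : κ⁻¹ * ∫⁻ y, ‖u y‖ₑ ∂μ ≠ ∞ :=
      ENNReal.mul_ne_top (ENNReal.inv_ne_top.2 hκ0) hu.2.ne
    refine ne_top_of_le_ne_top (b := L₁ * (κ⁻¹ * ∫⁻ y, ‖u y‖ₑ ∂μ) ^ p * μ Ω + L₂ * I) ?_ ?_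
    · exact ENNReal.add_ne_top.2 ⟨ENNReal.mul_ne_top (ENNReal.mul_ne_top ENNReal.ofReal_ne_top
        (ENNReal.rpow_ne_top_of_nonneg hp0.le hC)) hμΩ,
        ENNReal.mul_ne_top ENNReal.ofReal_ne_top hItop⟩
    · rw [hI, ← lintegral_const_mul' _ _ ENNReal.ofReal_ne_top, ← setLIntegral_const,
        ← lintegral_add_left measurable_const]
      refine setLIntegral_mono' hΩ fun x hx => (hpt x hx).1.trans ?_
      gcongr
      have h := (hpt x hx).2 le_rfl
      simp only [ENNReal.rpow_one] at h
      refine h.trans ?_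
      gcongr
      exact Measure.restrict_le_self
  set A := ∫⁻ x in Ω, w x * ‖u x‖ₑ ^ p ∂μ with hA
  have hAfin : A ≠ ∞ := by
    refine ne_top_of_le_ne_top (ENNReal.mul_ne_top hDt hafin) ?_
    rw [← lintegral_const_mul' _ _ hDt]
    refine setLIntegral_mono' hΩ fun x hx => ?_
    gcongr
    exact hwD x hx
  have haA : ∫⁻ x in Ω, ‖u x‖ₑ ^ p ∂μ ≤ A := by
    refine setLIntegral_mono' hΩ fun x hx => ?_
    calc ‖u x‖ₑ ^ p = 1 * ‖u x‖ₑ ^ p := (one_mul _).symm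
      _ ≤ _ := by gcongr; exact hw1 x hx
  set F : X × X → ℝ≥0∞ := {q : X × X | q.1 ∈ Ω ∧ q.2 ∈ Ψ q.1}.indicator
    fun q => w q.1 * ‖u q.2‖ₑ ^ p with hF
  have hFm : AEMeasurable F (μ.prod μ) := by
    refine AEMeasurable.indicator (AEMeasurable.mul (by fun_prop) ?_) hgraph
    exact (hu.1.enorm.pow_const p).comp_snd
  have hFx : ∀ x ∈ Ω, w x * ∫⁻ y in Ψ x, ‖u y‖ₑ ^ p ∂μ = ∫⁻ y, F (x, y) ∂μ := by
    intro x hx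
    rw [← lintegral_const_mul' _ _ (ne_top_of_le_ne_top hDt (hwD x hx)),
      ← lintegral_indicator (hΨ x hx)]
    refine lintegral_congr fun y => ?_
    by_cases hy : y ∈ Ψ x
    · have hxy : (x, y) ∈ {q : X × X | q.1 ∈ Ω ∧ q.2 ∈ Ψ q.1} := ⟨hx, hy⟩
      rw [indicator_of_mem hy, hF, indicator_of_mem hxy]
    · rw [indicator_of_notMem hy, hF, indicator_of_notMem fun h => hy h.2]
  have hFy : ∀ y, ∫⁻ x, F (x, y) ∂μ = (∫⁻ x in {x ∈ Ω | y ∈ Ψ x}, w x ∂μ) * ‖u y‖ₑ ^ p := by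
    intro y
    rw [← lintegral_mul_const _ hw, ← lintegral_indicator (hΨinv y)]
    rfl
  have hswap : ∫⁻ x in Ω, ∫⁻ y, F (x, y) ∂μ ∂μ ≤ κ * (ν * A) := by
    calc _ ≤ ∫⁻ x, ∫⁻ y, F (x, y) ∂μ ∂μ := setLIntegral_le_lintegral _ _
      _ = ∫⁻ y, ∫⁻ x, F (x, y) ∂μ ∂μ := lintegral_lintegral_swap hFm
      _ ≤ ∫⁻ y, Ω.indicator (fun y => κ * ν * (w y * ‖u y‖ₑ ^ p)) y ∂μ := by
        refine lintegral_mono_ae ?_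
        filter_upwards [hu0] with y hy
        rw [hFy]
        by_cases hyΩ : y ∈ Ω
        · rw [indicator_of_mem hyΩ]
          calc _ ≤ κ * (ν * w y) * ‖u y‖ₑ ^ p := by gcongr; exact hν y hyΩ
            _ = _ := by ring
        · by_cases hex : ∃ x ∈ Ω, y ∈ Ψ x
          · simp [hy hyΩ hex, hp0]
          · have : {x ∈ Ω | y ∈ Ψ x} = ∅ := by
              ext x
              simp only [mem_ofPred_eq, mem_empty_iff_false, iff_false]
              exact fun h => hex ⟨x, h⟩
            simp [this]
      _ = _ := by
        rw [lintegral_indicator hΩ, lintegral_const_mul'', mul_assoc]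
        exact (hw.aemeasurable.mul (hu.1.enorm.pow_const p)).restrict
  have hmain : A ≤ L₁ * ν * A + L₂ * (D * I) := by
    calc A ≤ ∫⁻ x in Ω, (L₁ * κ⁻¹ * ∫⁻ y, F (x, y) ∂μ +
          L₂ * D * ‖⨍ y in Ψ x, (u y - u x) ∂μ‖ₑ ^ p) ∂μ := by
          refine setLIntegral_mono' hΩ fun x hx => ?_
          calc w x * ‖u x‖ₑ ^ p ≤ w x * (L₁ * (κ⁻¹ * ∫⁻ y in Ψ x, ‖u y‖ₑ ^ p ∂μ) +
                L₂ * ‖⨍ y in Ψ x, (u y - u x) ∂μ‖ₑ ^ p) := by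
                gcongr
                refine (hpt x hx).1.trans ?_
                gcongr
                exact (hpt x hx).2 hp
            _ = L₁ * κ⁻¹ * (w x * ∫⁻ y in Ψ x, ‖u y‖ₑ ^ p ∂μ) +
                L₂ * w x * ‖⨍ y in Ψ x, (u y - u x) ∂μ‖ₑ ^ p := by ring
            _ ≤ _ := by
                rw [hFx x hx]
                gcongr
                exact hwD x hx
      _ = L₁ * κ⁻¹ * ∫⁻ x in Ω, ∫⁻ y, F (x, y) ∂μ ∂μ + L₂ * D * I := by
          have hm : AEMeasurable (fun x => ∫⁻ y, F (x, y) ∂μ) (μ.restrict Ω) :=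
            hFm.lintegral_prod_right'.restrict
          rw [lintegral_add_left' (hm.const_mul _), lintegral_const_mul'' _ hm,
            lintegral_const_mul' _ _ (ENNReal.mul_ne_top ENNReal.ofReal_ne_top hDt)]
      _ ≤ L₁ * κ⁻¹ * (κ * (ν * A)) + L₂ * D * I := by gcongr
      _ = L₁ * (κ⁻¹ * κ) * ν * A + L₂ * (D * I) := by ring
      _ = _ := by rw [ENNReal.inv_mul_cancel hκ0 hκt, mul_one]
  calc _ ≤ (1 - L₁ * ν) * A := by gcongr
    _ = A - L₁ * ν * A := by rw [ENNReal.sub_mul fun _ _ => hAfin, one_mul]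
    _ ≤ _ := tsub_le_iff_left.2 hmain

lemma lintegral_backward_half_ball_le {n : ℕ} (hn : 1 ≤ n) {δ η : ℝ} (hδ : 0 < δ)
    (hη : η = (2 / ((n : ℝ) + 1)) *
      ((μH[(n : ℝ) - 1] (Metric.ball (0 : EuclideanSpace ℝ (Fin (n - 1))) 1)).toReal /
       (μH[(n : ℝ)] (Metric.ball (0 : EuclideanSpace ℝ (Fin n)) 1)).toReal)) :
    0 ≤ η ∧ η ≤ 1 ∧ ∀ (y : EuclideanSpace ℝ (Fin n)) (W : ℝ), δ ≤ W →
      ∫⁻ x in {x | y ∈ ball x δ ∩ {y | 0 < (y - x) ⟨0, hn⟩}},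
        ENNReal.ofReal (W - (y - x) ⟨0, hn⟩) ≤
      ENNReal.ofReal ((W - η * δ) / 2) *
        volume (ball (0 : EuclideanSpace ℝ (Fin n)) δ) := by
  obtain ⟨m, rfl⟩ : ∃ m, n = m + 1 := ⟨n - 1, by omega⟩
  have hη0 : 0 ≤ η := by rw [hη]; positivity
  have hη' : η ≤ 2 / ((m : ℝ) + 2) *
      ((volume (ball (0 : EuclideanSpace ℝ (Fin m)) 1)).toReal /
      (volume (ball (0 : EuclideanSpace ℝ (Fin (m + 1))) 1)).toReal) := by
    rw [hη]
    have h := hausdorffMeasure_ball_ratio_le m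
    push_cast
    rw [add_sub_cancel_right, add_assoc, one_add_one_eq_two]
    exact mul_le_mul_of_nonneg_left h (by positivity)
  have hB0 : volume (ball (0 : EuclideanSpace ℝ (Fin (m + 1))) δ) ≠ 0 :=
    (measure_ball_pos _ _ hδ).ne'
  have hBt : volume (ball (0 : EuclideanSpace ℝ (Fin (m + 1))) δ) ≠ ∞ := measure_ball_lt_top.ne
  refine ⟨hη0, ?_, fun y W hW => ?_⟩
  · have h := (le_add_left le_rfl).trans
      (lintegral_sub_coord_half_ball_add_le m hδ hη' hη0 le_rfl)
    rw [ENNReal.mul_le_mul_iff_left hB0 hBt, ENNReal.ofReal_le_ofReal_iff (by positivity)] at h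
    by_contra hc
    nlinarith
  · set H := ball (0 : EuclideanSpace ℝ (Fin (m + 1))) δ ∩ {z | 0 < z 0} with hH
    have hHm : MeasurableSet H :=
      measurableSet_ball.inter (measurableSet_lt measurable_const (by fun_prop))
    have hset : {x | y ∈ ball x δ ∩ {y | 0 < (y - x) ⟨0, hn⟩}} = (fun x => y - x) ⁻¹' H := by
      ext x
      simp only [hH, mem_preimage, mem_inter_iff, mem_ball_zero_iff, ← dist_eq_norm]
      rfl
    have hcv : ∫⁻ x in (fun x => y - x) ⁻¹' H, ENNReal.ofReal (W - (y - x) 0) =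
        ∫⁻ z in H, ENNReal.ofReal (W - z 0) :=
      (Measure.measurePreserving_sub_left volume y).setLIntegral_comp_preimage hHm
        (f := fun z => ENNReal.ofReal (W - z 0)) (by fun_prop)
    rw [hset]
    refine hcv.trans_le ?_
    have h := ENNReal.le_sub_of_add_le_right (ENNReal.mul_ne_top ENNReal.ofReal_ne_top hBt)
      (lintegral_sub_coord_half_ball_add_le m hδ hη' hη0 hW)
    rwa [← ENNReal.sub_mul fun _ _ => hBt, ← ENNReal.ofReal_sub _ (by positivity),
      ← sub_div] at h

lemma one_le_poincare_quotient {ν p l : ℝ} (hν : 0 ≤ ν) (hp : 1 ≤ p) (hl0 : 0 < l) (hl1 : l < 1)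
    (hνl : ν < l ^ (p - 1)) : 1 ≤ (l / (1 - l)) ^ (p - 1) / (l ^ (p - 1) - ν) := by
  rw [one_le_div (by linarith)]
  refine (sub_le_self _ hν).trans (Real.rpow_le_rpow hl0.le ?_ (by linarith))
  rw [le_div_iff₀ (by linarith)]
  nlinarith

/-- If each quotient defining `poincareC` gives an upper bound, then so does `poincareC`. -/
lemma le_ofReal_poincareC_mul {ν p M : ℝ} (hν0 : 0 ≤ ν) (hν1 : ν < 1) (hp : 1 ≤ p) (hM : 0 < M)
    {X I : ℝ≥0∞} (h : ∀ l : ℝ, 0 < l → l < 1 → ν < l ^ (p - 1) →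
      X ≤ ENNReal.ofReal ((l / (1 - l)) ^ (p - 1) / (l ^ (p - 1) - ν) * M) * I) :
    X ≤ ENNReal.ofReal (poincareC ν p * M) * I := by
  unfold poincareC
  split_ifs with hp1
  · have := h 2⁻¹ (by norm_num) (by norm_num) (by simpa [hp1] using hν1)
    simpa [hp1] using this
  · have hp' : 0 < p - 1 := by
      rcases hp.lt_or_eq with hlt | heq
      · linarith
      · exact absurd heq.symm hp1
    set S := (fun l : ℝ => (l / (1 - l)) ^ (p - 1) / (l ^ (p - 1) - ν)) ''
      {l : ℝ | ν ^ (1 / (p - 1)) < l ∧ l < 1} with hS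
    have hmem : ∀ l : ℝ, ν ^ (1 / (p - 1)) < l → 0 < l ∧ ν < l ^ (p - 1) := by
      intro l hl
      have hr := Real.rpow_nonneg hν0 (1 / (p - 1))
      refine ⟨hr.trans_lt hl, ?_⟩
      have := Real.rpow_lt_rpow hr hl hp'
      rwa [← Real.rpow_mul hν0, one_div_mul_cancel hp'.ne', Real.rpow_one] at this
    have hne : S.Nonempty := by
      obtain ⟨l, hl⟩ := exists_between (Real.rpow_lt_one hν0 hν1 (one_div_pos.2 hp'))
      exact ⟨_, l, hl, rfl⟩
    have hS1 : 1 ≤ sInf S := by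
      refine le_csInf hne ?_
      rintro _ ⟨l, hl, rfl⟩
      exact one_le_poincare_quotient hν0 hp (hmem l hl.1).1 hl.2 (hmem l hl.1).2
    have hSX : ∀ k ∈ S, X ≤ ENNReal.ofReal (k * M) * I := by
      rintro _ ⟨l, hl, rfl⟩
      exact h l (hmem l hl.1).1 hl.2 (hmem l hl.1).2
    by_cases hI : I = ∞
    · rw [hI, ENNReal.mul_top (ENNReal.ofReal_pos.2 (by positivity)).ne']
      exact le_top
    have hXt : X ≠ ∞ := by
      obtain ⟨k, hk⟩ := hne
      exact ne_top_of_le_ne_top (ENNReal.mul_ne_top ENNReal.ofReal_ne_top hI) (hSX k hk)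
    have hreal : ∀ k : ℝ, 0 ≤ k → (X ≤ ENNReal.ofReal (k * M) * I ↔
        X.toReal ≤ k * (M * I.toReal)) := by
      intro k hk
      rw [← ENNReal.toReal_le_toReal hXt (ENNReal.mul_ne_top ENNReal.ofReal_ne_top hI),
        ENNReal.toReal_mul, ENNReal.toReal_ofReal (by positivity), mul_assoc]
    have hpos : ∀ k ∈ S, 0 ≤ k := fun k hk =>
      zero_le_one.trans (hS1.trans (csInf_le ⟨1, by
        rintro _ ⟨l, hl, rfl⟩
        exact one_le_poincare_quotient hν0 hp (hmem l hl.1).1 hl.2 (hmem l hl.1).2⟩ hk))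
    rw [hreal _ (by linarith)]
    rcases (mul_nonneg hM.le ENNReal.toReal_nonneg : 0 ≤ M * I.toReal).eq_or_lt with h0 | h0
    · obtain ⟨k, hk⟩ := hne
      have := (hreal k (hpos k hk)).1 (hSX k hk)
      rw [← h0, mul_zero] at this ⊢
      exact this
    · rw [← div_le_iff₀ h0]
      refine le_csInf hne fun k hk => ?_
      rw [div_le_iff₀ h0]
      exact (hreal k (hpos k hk)).1 (hSX k hk)

lemma exists_coord_bounds {n : ℕ} {Ω : Set (EuclideanSpace ℝ (Fin n))} (hne : Ω.Nonempty)
    (hb : Bornology.IsBounded Ω) (i : Fin n) :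
    ∃ m : ℝ, ∀ x ∈ Ω, m ≤ x i ∧ x i ≤ m + diam Ω := by
  have hd : ∀ x ∈ Ω, ∀ y ∈ Ω, x i - diam Ω ≤ y i := by
    intro x hx y hy
    have h1 := (abs_le.1 (abs_coord_le_norm (x - y) i)).2
    have h2 := dist_le_diam_of_mem hb hx hy
    rw [dist_eq_norm] at h2
    simp only [PiLp.sub_apply] at h1
    linarith
  obtain ⟨x₀, hx₀⟩ := hne
  refine ⟨sInf ((fun x => x i) '' Ω), fun x hx => ⟨csInf_le ⟨x₀ i - diam Ω, ?_⟩ ⟨x, hx, rfl⟩, ?_⟩⟩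
  · rintro _ ⟨y, hy, rfl⟩
    exact hd x₀ hx₀ y hy
  · rw [← sub_le_iff_le_add]
    refine le_csInf ⟨_, x₀, hx₀, rfl⟩ ?_
    rintro _ ⟨y, hy, rfl⟩
    exact hd x hx y hy

/-- Nonlocal Poincaré inequality for correspondences with measurable
supports contained in half-ball supports (`Ex:BasicEx1Ext`). -/
theorem stmt14 (n : ℕ) (hn : 1 ≤ n) (p : ℝ) (hp : 1 ≤ p)
    (Ω : Set (EuclideanSpace ℝ (Fin n)))
    (hΩopen : IsOpen Ω) (hΩne : Ω.Nonempty) (hΩbdd : Bornology.IsBounded Ω)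
    (δ : ℝ) (hδ0 : 0 < δ) (hδ1 : δ ≤ 1)
    (η : ℝ)
    (hη : η = (2 / ((n : ℝ) + 1)) *
      ((μH[(n : ℝ) - 1] (Metric.ball (0 : EuclideanSpace ℝ (Fin (n - 1))) 1)).toReal /
       (μH[(n : ℝ)] (Metric.ball (0 : EuclideanSpace ℝ (Fin n)) 1)).toReal))
    (Ψ : EuclideanSpace ℝ (Fin n) → Set (EuclideanSpace ℝ (Fin n)))
    (hΨmeas : ∀ x ∈ Ω, MeasurableSet (Ψ x))
    (hΨinvmeas : ∀ y, MeasurableSet {x ∈ Ω | y ∈ Ψ x})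
    (hgraph : MeasurableSet {q : EuclideanSpace ℝ (Fin n) × EuclideanSpace ℝ (Fin n) |
      q.1 ∈ Ω ∧ q.2 ∈ Ψ q.1})
    (hΨvolmeas : Measurable fun x => volume (Ψ x))
    (hΨsub : ∀ x ∈ Ω, Ψ x ⊆ Metric.ball x δ ∩ {y | 0 < (y - x) ⟨0, hn⟩})
    (τ : ℝ) (hτ1 : τ ≤ 1) (hτ : 1 - η * δ / (1 + Metric.diam Ω) < τ)
    (hΨvol : ∀ x ∈ Ω,
      ENNReal.ofReal (τ / 2) * volume (Metric.ball (0 : EuclideanSpace ℝ (Fin n)) δ) ≤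
        volume (Ψ x))
    (ντ : ℝ) (hντ : ντ = (1 / τ) * (1 - η * δ / (1 + Metric.diam Ω)))
    (Γ : Set (EuclideanSpace ℝ (Fin n)))
    (hΓ : Γ = closure ((⋃ x ∈ Ω, Ψ x) \ Ω))
    (u : EuclideanSpace ℝ (Fin n) → ℝ) (hu : Integrable u)
    (hu0 : ∀ᵐ x, x ∈ Γ → u x = 0) :
    ∫⁻ x in Ω, ENNReal.ofReal (|u x| ^ p) ≤
      ENNReal.ofReal (poincareC ντ p * (1 + Metric.diam Ω)) *
        ∫⁻ x in Ω, ENNReal.ofReal (|⨍ y in Ψ x, (u y - u x)| ^ p) := by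
  obtain ⟨hη0, hη1, hball⟩ := lintegral_backward_half_ball_le hn hδ0 hη
  set d := diam Ω with hd
  have hd0 : 0 ≤ d := diam_nonneg
  have hD : 0 < 1 + d := by linarith
  have hq : η * δ / (1 + d) ≤ 1 := by
    rw [div_le_one hD]
    nlinarith
  have hτ0 : 0 < τ := by linarith
  have hν0 : 0 ≤ ντ := by
    rw [hντ]
    exact mul_nonneg (one_div_nonneg.2 hτ0.le) (by linarith)
  have hτν : τ * ντ = 1 - η * δ / (1 + d) := by
    rw [hντ]
    field_simp
  have hν1 : ντ < 1 := by nlinarith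
  have hB0 : volume (ball (0 : EuclideanSpace ℝ (Fin n)) δ) ≠ 0 := (measure_ball_pos _ _ hδ0).ne'
  have hBt : volume (ball (0 : EuclideanSpace ℝ (Fin n)) δ) ≠ ∞ := measure_ball_lt_top.ne
  obtain ⟨m, hm⟩ := exists_coord_bounds hΩne hΩbdd ⟨0, hn⟩
  have henorm : ∀ t : ℝ, ENNReal.ofReal (|t| ^ p) = ‖t‖ₑ ^ p := fun t => by
    rw [Real.enorm_eq_ofReal_abs, ENNReal.ofReal_rpow_of_nonneg (abs_nonneg _) (by linarith)]
  simp only [henorm]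
  refine le_ofReal_poincareC_mul hν0 hν1 hp hD fun l hl0 hl1 hνl => ?_
  have hcore := lintegral_rpow_le_of_weight (μ := volume) hp hl0 hl1 hΩopen.measurableSet
    hΩbdd.measure_lt_top.ne hΨmeas hΨinvmeas hgraph
    (κ := ENNReal.ofReal (τ / 2) * volume (ball (0 : EuclideanSpace ℝ (Fin n)) δ))
    (mul_ne_zero (ENNReal.ofReal_pos.2 (by positivity)).ne' hB0)
    (ENNReal.mul_ne_top ENNReal.ofReal_ne_top hBt) hΨvol
    (fun x hx => ne_top_of_le_ne_top (measure_ball_lt_top (x := x) (r := δ)).ne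
      (measure_mono ((hΨsub x hx).trans inter_subset_left)))
    (w := fun x => ENNReal.ofReal (1 + x ⟨0, hn⟩ - m)) (by fun_prop)
    (D := ENNReal.ofReal (1 + d)) (ENNReal.ofReal_pos.2 hD).ne' ENNReal.ofReal_ne_top
    (fun x hx => by
      rw [ENNReal.one_le_ofReal]
      linarith [(hm x hx).1])
    (fun x hx => ENNReal.ofReal_le_ofReal (by linarith [(hm x hx).2]))
    (ν := ENNReal.ofReal ντ) (fun y hy => ?_) hu ?_
  · have hl : l ^ (1 - p) = (l ^ (p - 1))⁻¹ := by rw [← Real.rpow_neg hl0.le, neg_sub]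
    have hl' : (1 - l) ^ (1 - p) = ((1 - l) ^ (p - 1))⁻¹ := by
      rw [← Real.rpow_neg (by linarith), neg_sub]
    have hlp : 0 < l ^ (p - 1) := Real.rpow_pos_of_pos hl0 _
    have hlp' : 0 < (1 - l) ^ (p - 1) := Real.rpow_pos_of_pos (by linarith) _
    have hc : 0 < 1 - l ^ (1 - p) * ντ := by
      rw [hl, sub_pos, inv_mul_lt_one₀ hlp]
      exact hνl
    rw [← ENNReal.ofReal_mul (by positivity), ← ENNReal.ofReal_one,
      ← ENNReal.ofReal_sub _ (by positivity)] at hcore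
    refine (ENNReal.mul_le_mul_iff_right (ENNReal.ofReal_pos.2 hc).ne' ENNReal.ofReal_ne_top).1 ?_
    refine hcore.trans_eq ?_
    rw [← mul_assoc, ← mul_assoc, ← ENNReal.ofReal_mul (by positivity),
      ← ENNReal.ofReal_mul hc.le]
    congr 2
    have : l ^ (p - 1) - ντ ≠ 0 := by linarith
    rw [hl, hl', Real.div_rpow hl0.le (by linarith)]
    field_simp
  · set W := 1 + y ⟨0, hn⟩ - m with hW
    have hW1 : 1 ≤ W := by linarith [(hm y hy).1]
    have hWD : W ≤ 1 + d := by linarith [(hm y hy).2]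
    calc ∫⁻ x in {x ∈ Ω | y ∈ Ψ x}, ENNReal.ofReal (1 + x ⟨0, hn⟩ - m)
        ≤ ∫⁻ x in {x | y ∈ ball x δ ∩ {y | 0 < (y - x) ⟨0, hn⟩}},
          ENNReal.ofReal (1 + x ⟨0, hn⟩ - m) :=
          lintegral_mono_set fun x hx => hΨsub x hx.1 hx.2
      _ = ∫⁻ x in {x | y ∈ ball x δ ∩ {y | 0 < (y - x) ⟨0, hn⟩}},
          ENNReal.ofReal (W - (y - x) ⟨0, hn⟩) := by
          refine lintegral_congr fun x => ?_
          congr 1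
          simp only [PiLp.sub_apply, hW]
          ring
      _ ≤ ENNReal.ofReal ((W - η * δ) / 2) *
          volume (ball (0 : EuclideanSpace ℝ (Fin n)) δ) := hball y W (hδ1.trans hW1)
      _ ≤ ENNReal.ofReal (τ / 2 * (ντ * W)) *
          volume (ball (0 : EuclideanSpace ℝ (Fin n)) δ) := by
          gcongr
          have h1 : τ / 2 * (ντ * W) = (W - η * δ * (W / (1 + d))) / 2 := by
            rw [show τ / 2 * (ντ * W) = τ * ντ * W / 2 by ring, hτν]
            ring
          rw [h1]
          have h2 : η * δ * (W / (1 + d)) ≤ η * δ * 1 := by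
            gcongr
            exact (div_le_one hD).2 hWD
          linarith
      _ = _ := by
          rw [ENNReal.ofReal_mul (by positivity), ENNReal.ofReal_mul hν0]
          ring
  · filter_upwards [hu0] with y hy hyΩ hex
    refine hy ?_
    rw [hΓ]
    refine subset_closure ⟨?_, hyΩ⟩
    obtain ⟨x, hx, hxy⟩ := hex
    exact mem_biUnion hx hxy
end

section
/- Work in ℝ². Let 1 ≤ p < ∞, Ω := (0,2)², Ω₁ := (0,1)×(0,2), Ω₂ := (1,2)×(0,2). Let 0 < δ₁ < 1, U₁ := (1−δ₁,1+δ₁)×(−1,0), U₂ := (1−δ₁,1+δ₁)×(2,3), U := U₁ ∪ U₂. Let 0 < θ ≤ π/4 and 0 < δ₂ < δ₁ sin θ, and set Z₁ := { z = (z₁,z₂) ∈ C_θ(0; e₁) : z₁ < δ₁ and |z₂| > δ₂ } and Z₂ := −Z₁. Define Z(x) := Z₁ for x ∈ Ω₁ and Z(x) := Z₂ for x ∈ Ω₂, and Ψ(x) := (Ω ∪ U) ∩ (x + Z(x)) for x ∈ Ω₁ ∪ Ω₂. Suppose μ : ℝ² × ℝ² → [0,∞) is measurable and there exists C < ∞ such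 that μ(x, y−x)·C ≥ |y₂ − x₂|^{−(p+1)}·|Z₁|^{−1} for a.e. x ∈ Ω and a.e. y ∈ Ψ(x). If u : ℝ² → ℝ is measurable and u = 0 a.e. on U, then ∫_Ω |u(x)|^p dx ≤ 2^{p+4}·C·∫_Ω ∫_{Ψ(x)} |u(y) − u(x)|^p μ(x, y−x) dy dx. -/
open MeasureTheory Metric Set
open scoped ENNReal NNReal

/-- A walker at distance `d` from the interface and `t` from the exit line moves by `a` horizontally,
always towards the interface, and by `h` vertically in a direction of its choice. It can exit in at
most `2 / h` steps, close to the interface, without visiting a point twice. -/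
theorem exists_zigzag {a h d t : ℝ} (hh : 0 < h) (hha : h < a) (ha : a < 1)
    (hd0 : 0 < d) (hd1 : d < 1) (ht0 : 0 < t) (ht1 : t ≤ 1)
    (hda : ∀ n : ℤ, d ≠ n * a) (hth : ∀ n : ℤ, t ≠ n * h) :
    ∃ (N : ℕ) (i s : ℕ → ℤ), i 0 = 0 ∧ s 0 = 0 ∧ N * h ≤ 2 ∧
      (∀ j l, j < N → l < N → i j = i l → s j = s l → j = l) ∧
      (∀ j < N, 0 ≤ i j ∧ (i j - 1) * a < d ∧ -1 ≤ s j ∧ s j * h < t ∧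
        ((i j * a < d ∧ i (j + 1) = i j + 1) ∨ (d < i j * a ∧ i (j + 1) = i j - 1)) ∧
        (s (j + 1) = s j + 1 ∨ s (j + 1) = s j - 1)) ∧
      |d - i N * a| < a ∧ t < s N * h ∧ (s N - 1) * h < t := by
  have ha0 : 0 < a := hh.trans hha
  have first_passage : ∀ {b c : ℝ}, 0 < b → 0 < c → (∀ n : ℤ, c ≠ n * b) →
      ∃ q : ℕ, c < (q + 1) * b ∧ q * b < c := by
    intro b c hb hc hne
    refine ⟨⌊c / b⌋₊, ?_, ?_⟩
    · rw [← div_lt_iff₀ hb]; exact Nat.lt_floor_add_one _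
    · have h1 := Nat.floor_le (div_nonneg hc.le hb.le)
      rw [le_div_iff₀ hb] at h1
      exact lt_of_le_of_ne h1 fun h2 => hne ⌊c / b⌋₊ (by push_cast; exact h2.symm)
  obtain ⟨q, hq1, hq2⟩ := first_passage ha0 hd0 hda
  obtain ⟨m, hm1, hm2⟩ := first_passage hh ht0 hth
  obtain ⟨e, he⟩ : ∃ e : ℕ, e = (q - (m + 1)) + (q - (m + 1)) % 2 := ⟨_, rfl⟩
  have below : ∀ n : ℤ, n ≤ q → n * a < d := fun n hn =>
    (mul_le_mul_of_nonneg_right (by exact_mod_cast hn) ha0.le).trans_lt hq2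
  refine ⟨m + 1 + e, fun j => if j ≤ q + 1 then j else (q + 1 : ℤ) - ((j - (q + 1) : ℕ) % 2 : ℕ),
    fun j => if j ≤ e then -((j % 2 : ℕ) : ℤ) else j - e, by simp, by simp, ?_, ?_, ?_, ?_, ?_, ?_⟩
  · by_cases h0 : e = 0
    · subst h0; push_cast; linarith
    · have : m + 1 + e ≤ q + 1 := by omega
      have h3 : ((m + 1 + e : ℕ) : ℝ) ≤ q + 1 := by exact_mod_cast this
      have h4 : (q : ℝ) * h ≤ q * a := by gcongr
      nlinarith
  · intro j l hj hl h1 h2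
    simp only at h1 h2
    split_ifs at h1 h2 <;> omega
  · intro j hj
    simp only
    set I : ℤ := if j ≤ q + 1 then (j : ℤ) else (q + 1 : ℤ) - ((j - (q + 1) : ℕ) % 2 : ℕ) with hI
    set S : ℤ := if j ≤ e then -((j % 2 : ℕ) : ℤ) else j - e with hS
    have hI0 : 0 ≤ I := by rw [hI]; split_ifs <;> omega
    have hI1 : I ≤ q + 1 := by rw [hI]; split_ifs <;> omega
    have hS0 : -1 ≤ S := by rw [hS]; split_ifs <;> omega
    have hS1 : S ≤ m := by rw [hS]; split_ifs <;> omega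
    refine ⟨hI0, by exact_mod_cast below (I - 1) (by omega), hS0, ?_, ?_, ?_⟩
    · exact (mul_le_mul_of_nonneg_right (by exact_mod_cast hS1) hh.le).trans_lt hm2
    · rcases hI1.lt_or_eq with h1 | h1
      · refine Or.inl ⟨below I (by omega), ?_⟩
        rw [hI] at h1 ⊢; split_ifs at h1 ⊢ <;> omega
      · refine Or.inr ⟨by rw [h1]; push_cast; exact hq1, ?_⟩
        rw [hI] at h1 ⊢; split_ifs at h1 ⊢ <;> omega
    · rw [hS]; split_ifs <;> omega
  · simp only
    set I : ℤ := if m + 1 + e ≤ q + 1 then ((m + 1 + e : ℕ) : ℤ) else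
      (q + 1 : ℤ) - ((m + 1 + e - (q + 1) : ℕ) % 2 : ℕ) with hI
    have hI1 : I = q ∨ I = q + 1 := by rw [hI]; split_ifs <;> omega
    rcases hI1 with h1 | h1 <;> rw [h1, abs_lt] <;> push_cast <;> constructor <;> linarith
  · simp only [if_neg (show ¬ m + 1 + e ≤ e by omega)]
    push_cast; linarith
  · simp only [if_neg (show ¬ m + 1 + e ≤ e by omega)]
    push_cast; linarith

/-- Each generic point of `(0, 2) ²` can be joined to the exit windows above and below the interface
by a self-avoiding lattice path of at most `2 / h` steps that stays in a box of lattice vectors. -/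
theorem exists_lattice_path {a h x y : ℝ} (hh : 0 < h) (hha : h < a) (ha : a < 1)
    (hx : x ∈ Ioo (0 : ℝ) 2) (hy : y ∈ Ioo (0 : ℝ) 2)
    (hxa : ∀ n : ℤ, x + n * a ≠ 1) (hy0 : ∀ n : ℤ, y + n * h ≠ 0) (hy2 : ∀ n : ℤ, y + n * h ≠ 2) :
    ∃ (N : ℕ) (i s : ℕ → ℤ), i 0 = 0 ∧ s 0 = 0 ∧ N * h ≤ 2 ∧
      (∀ j l, j < N → l < N → i j = i l → s j = s l → j = l) ∧
      (∀ j < N, x + i j * a ∈ Ioo (0 : ℝ) 2 ∧ y + s j * h ∈ Ioo (0 : ℝ) 2 ∧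
        ((x + i j * a < 1 ∧ i (j + 1) = i j + 1) ∨ (1 < x + i j * a ∧ i (j + 1) = i j - 1)) ∧
        (s (j + 1) = s j + 1 ∨ s (j + 1) = s j - 1) ∧
        |i j| ≤ ⌈1 / a⌉ ∧ |s j| ≤ ⌈1 / h⌉ - 1) ∧
      x + i N * a ∈ Ioo (1 - a) (1 + a) ∧
      (y + s N * h ∈ Ioo (-1 : ℝ) 0 ∨ y + s N * h ∈ Ioo (2 : ℝ) 3) := by
  have ha0 : 0 < a := hh.trans hha
  have hx1 := hxa 0
  obtain ⟨hx0, hx2⟩ := hx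
  obtain ⟨hy0', hy2'⟩ := hy
  obtain ⟨σ, d, hσ, hd0, hd1, hxd⟩ : ∃ (σ : ℤ) (d : ℝ), (σ = 1 ∨ σ = -1) ∧ 0 < d ∧ d < 1 ∧
      x = 1 - σ * d := by
    rcases lt_or_gt_of_ne hx1 with h1 | h1
    · exact ⟨1, 1 - x, by simp, by simp at h1; linarith, by linarith, by push_cast; ring⟩
    · exact ⟨-1, x - 1, by simp, by simp at h1; linarith, by linarith, by push_cast; ring⟩
  obtain ⟨τ, t, hτ, ht0, ht1, hyt⟩ : ∃ (τ : ℤ) (t : ℝ), (τ = 1 ∨ τ = -1) ∧ 0 < t ∧ t ≤ 1 ∧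
      y = 1 + τ * (1 - t) := by
    rcases le_total 1 y with h1 | h1
    · exact ⟨1, 2 - y, by simp, by linarith, by linarith, by push_cast; ring⟩
    · exact ⟨-1, y, by simp, by linarith, by linarith, by push_cast; ring⟩
  obtain ⟨N, i, s, hi0, hs0, hN, hinj, hstep, hiN, hsN, hsN'⟩ :=
    exists_zigzag (a := a) (h := h) (d := d) (t := t) hh hha ha hd0 hd1 ht0 ht1 (by
      intro n hn
      apply hxa (σ * n)
      rcases hσ with rfl | rfl <;> push_cast <;> rw [hxd, hn] <;> push_cast <;> ring) (by
      intro n hn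
      rcases hτ with rfl | rfl
      · apply hy2 n
        rw [hyt, hn]; push_cast; ring
      · apply hy0 (-n)
        rw [hyt, hn]; push_cast; ring)
  refine ⟨N, fun j => σ * i j, fun j => τ * s j, by simp [hi0], by simp [hs0], hN, ?_, ?_, ?_, ?_⟩
  · intro j l hj hl h1 h2
    refine hinj j l hj hl ?_ ?_
    · rcases hσ with rfl | rfl <;> simpa using h1
    · rcases hτ with rfl | rfl <;> simpa using h2
  · intro j hj
    obtain ⟨h1, h2, h3, h4, h5, h6⟩ := hstep j hj
    have h1' : (0 : ℝ) ≤ i j * a := mul_nonneg (by exact_mod_cast h1) ha0.le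
    have h3' : -h ≤ s j * h := by
      have : (-1 : ℝ) ≤ s j := by exact_mod_cast h3
      nlinarith
    have hia : |i j| ≤ ⌈1 / a⌉ := by
      rw [abs_of_nonneg h1]
      have : ((i j - 1 : ℤ) : ℝ) < ⌈1 / a⌉ := by
        refine lt_of_lt_of_le ?_ (Int.le_ceil _)
        rw [lt_div_iff₀ ha0]; push_cast; linarith
      have : i j - 1 < ⌈1 / a⌉ := by exact_mod_cast this
      omega
    have hsh : |s j| ≤ ⌈1 / h⌉ - 1 := by
      have e1 : ((s j : ℤ) : ℝ) < ⌈1 / h⌉ := by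
        refine lt_of_lt_of_le ?_ (Int.le_ceil _)
        rw [lt_div_iff₀ hh]; linarith
      have e2 : ((1 : ℤ) : ℝ) < ⌈1 / h⌉ := by
        refine lt_of_lt_of_le ?_ (Int.le_ceil _)
        rw [lt_div_iff₀ hh]; push_cast; linarith
      have e1 : s j < ⌈1 / h⌉ := by exact_mod_cast e1
      have e2 : 1 < ⌈1 / h⌉ := by exact_mod_cast e2
      rw [abs_le]; omega
    rcases hσ with rfl | rfl <;> rcases hτ with rfl | rfl <;> push_cast at * <;>
      simp only [abs_neg, neg_mul, one_mul] at * <;>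
      refine ⟨⟨by linarith, by linarith⟩, ⟨by linarith, by linarith⟩, ?_, by omega, hia, hsh⟩ <;>
      rcases h5 with ⟨h5, h5'⟩ | ⟨h5, h5'⟩
    all_goals first
      | exact Or.inl ⟨by linarith, by omega⟩
      | exact Or.inr ⟨by linarith, by omega⟩
  · rw [abs_lt] at hiN
    rcases hσ with rfl | rfl <;> push_cast at * <;> constructor <;> linarith
  · rcases hτ with rfl | rfl <;> push_cast at *
    · exact Or.inr ⟨by linarith, by linarith⟩
    · exact Or.inl ⟨by linarith, by linarith⟩

/-- The `p`-th power of the increment of `u` along the step from `w` by `z` if `w ∈ Ω₁` and by `-z` if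
`w ∈ Ω₂`, counted only if the step ends in `W`. -/
noncomputable def stepEnergy (p : ℝ) (Ω₁ Ω₂ W : Set (EuclideanSpace ℝ (Fin 2)))
    (u : EuclideanSpace ℝ (Fin 2) → ℝ) (z w : EuclideanSpace ℝ (Fin 2)) : ℝ≥0∞ :=
  Ω₁.indicator (fun w => W.indicator (fun y => ENNReal.ofReal (|u y - u w| ^ p)) (w + z)) w +
    Ω₂.indicator (fun w => W.indicator (fun y => ENNReal.ofReal (|u y - u w| ^ p)) (w - z)) w

theorem measurable_indicator_energy {p : ℝ} {S W : Set (EuclideanSpace ℝ (Fin 2))}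
    {u : EuclideanSpace ℝ (Fin 2) → ℝ} (hS : MeasurableSet S) (hW : MeasurableSet W)
    (hu : Measurable u)
    {T : EuclideanSpace ℝ (Fin 2) → EuclideanSpace ℝ (Fin 2) → EuclideanSpace ℝ (Fin 2)}
    (hT : Measurable fun q : EuclideanSpace ℝ (Fin 2) × EuclideanSpace ℝ (Fin 2) => T q.1 q.2) :
    Measurable fun q : EuclideanSpace ℝ (Fin 2) × EuclideanSpace ℝ (Fin 2) =>
      S.indicator (fun w => W.indicator (fun y => ENNReal.ofReal (|u y - u w| ^ p)) (T q.1 w))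
        q.2 := by
  have hF : Measurable fun q : EuclideanSpace ℝ (Fin 2) × EuclideanSpace ℝ (Fin 2) =>
      ENNReal.ofReal (|u (T q.1 q.2) - u q.2| ^ p) := by
    have h1 : Measurable fun q : EuclideanSpace ℝ (Fin 2) × EuclideanSpace ℝ (Fin 2) =>
        |u (T q.1 q.2) - u q.2| := by
      simpa [Real.norm_eq_abs] using ((hu.comp hT).sub (hu.comp measurable_snd)).norm
    exact (h1.pow_const p).ennreal_ofReal
  exact (hF.indicator (hT hW)).indicator (measurable_snd hS)

theorem measurable_stepEnergy {p : ℝ} {Ω₁ Ω₂ W : Set (EuclideanSpace ℝ (Fin 2))}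
    {u : EuclideanSpace ℝ (Fin 2) → ℝ} (h₁ : MeasurableSet Ω₁) (h₂ : MeasurableSet Ω₂)
    (hW : MeasurableSet W) (hu : Measurable u) :
    Measurable (Function.uncurry (stepEnergy p Ω₁ Ω₂ W u)) :=
  (measurable_indicator_energy (T := fun z w => w + z) h₁ hW hu (by fun_prop)).add
    (measurable_indicator_energy (T := fun z w => w - z) h₂ hW hu (by fun_prop))

theorem volume_coordinate_eq (i : Fin 2) (c : ℝ) :
    volume {x : EuclideanSpace ℝ (Fin 2) | x i = c} = 0 := by
  have h := (EuclideanSpace.volume_preserving_symm_measurableEquiv_toLp (Fin 2)).measure_preimage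
    (s := {f : Fin 2 → ℝ | f i = c})
    (measurableSet_eq_fun (measurable_pi_apply i) measurable_const).nullMeasurableSet
  rw [volume_pi, Measure.pi_hyperplane] at h
  exact h

theorem ae_coordinate_add_ne (i : Fin 2) (b c : ℝ) :
    ∀ᵐ x : EuclideanSpace ℝ (Fin 2), ∀ n : ℤ, x i + n * b ≠ c := by
  rw [ae_all_iff]
  intro n
  have := volume_coordinate_eq i (c - n * b)
  rw [ae_iff]
  convert this using 3
  simp [eq_sub_iff_add_eq]

theorem card_lattice_box_le {a h : ℝ} (hh : 0 < h) (hha : h < a) (ha : a < 1) :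
    ((Finset.Icc (-⌈1 / a⌉) ⌈1 / a⌉ ×ˢ Finset.Icc (-(⌈1 / h⌉ - 1)) (⌈1 / h⌉ - 1)).card : ℝ) ≤
      16 / h ^ 2 := by
  have ha0 := hh.trans hha
  have hA := Int.ceil_lt_add_one (1 / a)
  have hH := Int.ceil_lt_add_one (1 / h)
  have hA1 : 1 < 1 / a := by rwa [lt_div_iff₀ ha0, one_mul]
  have hAH : 1 / a ≤ 1 / h := by gcongr
  have hA2 := Int.le_ceil (1 / a)
  have hH2 := Int.le_ceil (1 / h)
  have hA0 : (0 : ℤ) ≤ ⌈1 / a⌉ := by exact_mod_cast (by linarith : (0 : ℝ) ≤ ⌈1 / a⌉)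
  have hH0 : (1 : ℤ) ≤ ⌈1 / h⌉ := by exact_mod_cast (by linarith : (1 : ℝ) ≤ ⌈1 / h⌉)
  rw [Finset.card_product, Int.card_Icc, Int.card_Icc]
  push_cast
  have e1 : (((⌈1 / a⌉ + 1 - -⌈1 / a⌉).toNat : ℕ) : ℝ) = 2 * ⌈1 / a⌉ + 1 := by
    rw [← Int.cast_natCast, Int.toNat_of_nonneg (by omega)]; push_cast; ring
  have e2 : (((⌈1 / h⌉ - 1 + 1 - -(⌈1 / h⌉ - 1)).toNat : ℕ) : ℝ) = 2 * ⌈1 / h⌉ - 1 := by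
    rw [← Int.cast_natCast, Int.toNat_of_nonneg (by omega)]; push_cast; ring
  rw [e1, e2]
  have e3 : 16 / h ^ 2 = 16 * ((1 / h) * (1 / h)) := by field_simp
  rw [e3]
  calc (2 * (⌈1 / a⌉ : ℝ) + 1) * (2 * ⌈1 / h⌉ - 1)
      ≤ (5 * (1 / h)) * (3 * (1 / h)) := by
        apply mul_le_mul <;> linarith
    _ ≤ _ := by nlinarith [mul_self_nonneg (1 / h)]

theorem abs_rpow_le_sum_stepEnergy {p : ℝ} (hp : 1 ≤ p)
    {Ω₁ Ω₂ U : Set (EuclideanSpace ℝ (Fin 2))}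
    (hΩ₁ : Ω₁ = {x | x 0 ∈ Set.Ioo (0 : ℝ) 1 ∧ x 1 ∈ Set.Ioo (0 : ℝ) 2})
    (hΩ₂ : Ω₂ = {x | x 0 ∈ Set.Ioo (1 : ℝ) 2 ∧ x 1 ∈ Set.Ioo (0 : ℝ) 2})
    {u : EuclideanSpace ℝ (Fin 2) → ℝ} {z z' x : EuclideanSpace ℝ (Fin 2)}
    (hz' : z' = !₂[z 0, -z 1]) (hz1 : 0 < |z 1|) (hz10 : |z 1| < z 0) (hz0 : z 0 < 1)
    (hU : ∀ y : EuclideanSpace ℝ (Fin 2), y 0 ∈ Ioo (1 - z 0) (1 + z 0) →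
      (y 1 ∈ Ioo (-1 : ℝ) 0 ∨ y 1 ∈ Ioo (2 : ℝ) 3) → y ∈ U)
    (hx0 : x 0 ∈ Ioo (0 : ℝ) 2) (hx1 : x 1 ∈ Ioo (0 : ℝ) 2)
    (hg0 : ∀ n : ℤ, x 0 + n * z 0 ≠ 1) (hg1 : ∀ n : ℤ, x 1 + n * |z 1| ≠ 0)
    (hg2 : ∀ n : ℤ, x 1 + n * |z 1| ≠ 2)
    (hu : ∀ k : ℤ × ℤ, x + !₂[k.1 * z 0, k.2 * |z 1|] ∈ U →
      u (x + !₂[k.1 * z 0, k.2 * |z 1|]) = 0) :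
    ENNReal.ofReal (|u x| ^ p) ≤ ENNReal.ofReal ((2 / |z 1|) ^ (p - 1)) *
      ∑ k ∈ Finset.Icc (-⌈1 / z 0⌉) ⌈1 / z 0⌉ ×ˢ Finset.Icc (-(⌈1 / |z 1|⌉ - 1)) (⌈1 / |z 1|⌉ - 1),
        (stepEnergy p Ω₁ Ω₂ ({x | x 0 ∈ Ioo (0 : ℝ) 2 ∧ x 1 ∈ Ioo (0 : ℝ) 2} ∪ U) u z
            (x + !₂[k.1 * z 0, k.2 * |z 1|]) +
          stepEnergy p Ω₁ Ω₂ ({x | x 0 ∈ Ioo (0 : ℝ) 2 ∧ x 1 ∈ Ioo (0 : ℝ) 2} ∪ U) u z'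
            (x + !₂[k.1 * z 0, k.2 * |z 1|])) := by
  obtain ⟨N, i, s, hi0, hs0, hN, hinj, hstep, hend0, hend1⟩ :=
    exists_lattice_path hz1 hz10 hz0 hx0 hx1 hg0 hg1 hg2
  set W := {x : EuclideanSpace ℝ (Fin 2) | x 0 ∈ Ioo (0 : ℝ) 2 ∧ x 1 ∈ Ioo (0 : ℝ) 2} ∪ U with hW
  set v : ℤ × ℤ → EuclideanSpace ℝ (Fin 2) := fun k => x + !₂[k.1 * z 0, k.2 * |z 1|] with hv
  obtain ⟨y, hy⟩ : ∃ y : ℕ → EuclideanSpace ℝ (Fin 2), ∀ j, y j = v (i j, s j) := ⟨_, fun _ => rfl⟩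
  have hy0 : ∀ j, y j 0 = x 0 + i j * z 0 := fun j => by simp [hy, hv]
  have hy1 : ∀ j, y j 1 = x 1 + s j * |z 1| := fun j => by simp [hy, hv]
  have hyx : y 0 = x := by
    ext l; fin_cases l
    · simp [hy0, hi0]
    · simp [hy1, hs0]
  have hyN : y N ∈ U := hU _ (by rw [hy0]; exact hend0) (by rw [hy1]; exact hend1)
  have huN : u (y N) = 0 := by
    rw [hy] at hyN ⊢
    exact hu _ hyN
  have hyW : ∀ j < N, y (j + 1) ∈ W := by
    intro j hj
    rcases (Nat.succ_le_of_lt hj).lt_or_eq with h1 | h1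
    · obtain ⟨e1, e2, -⟩ := hstep _ h1
      refine Or.inl ⟨?_, ?_⟩
      · rw [hy0]; exact e1
      · rw [hy1]; exact e2
    · have h1 : j + 1 = N := h1
      rw [h1]; exact Or.inr hyN
  have henergy : ∀ j < N, ENNReal.ofReal (|u (y (j + 1)) - u (y j)| ^ p) ≤
      stepEnergy p Ω₁ Ω₂ W u z (y j) + stepEnergy p Ω₁ Ω₂ W u z' (y j) := by
    intro j hj
    obtain ⟨e1, e2, e3, e4, -⟩ := hstep j hj
    have hz'0 : z' 0 = z 0 := by simp [hz']
    have hz'1 : z' 1 = -z 1 := by simp [hz']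
    rw [← hy0] at e1 e3
    rw [← hy1] at e2
    have right : ∀ ζ, y j 0 < 1 → y (j + 1) = y j + ζ →
        ENNReal.ofReal (|u (y (j + 1)) - u (y j)| ^ p) ≤ stepEnergy p Ω₁ Ω₂ W u ζ (y j) := by
      intro ζ h1 h2
      have m1 : y j ∈ Ω₁ := by rw [hΩ₁]; exact ⟨⟨e1.1, h1⟩, e2⟩
      have m2 : y j + ζ ∈ W := h2 ▸ hyW j hj
      rw [stepEnergy, indicator_of_mem m1, indicator_of_mem m2, ← h2]
      exact le_self_add
    have left : ∀ ζ, 1 < y j 0 → y (j + 1) = y j - ζ →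
        ENNReal.ofReal (|u (y (j + 1)) - u (y j)| ^ p) ≤ stepEnergy p Ω₁ Ω₂ W u ζ (y j) := by
      intro ζ h1 h2
      have m1 : y j ∈ Ω₂ := by rw [hΩ₂]; exact ⟨⟨h1, e1.2⟩, e2⟩
      have m2 : y j - ζ ∈ W := h2 ▸ hyW j hj
      rw [stepEnergy, indicator_of_mem m1, indicator_of_mem m2, ← h2]
      exact le_add_self
    have ext2 : ∀ α β : EuclideanSpace ℝ (Fin 2), α 0 = β 0 → α 1 = β 1 → α = β := by
      intro α β h0 h1
      ext l; fin_cases l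
      · exact h0
      · exact h1
    have d0 : (y j 0 < 1 ∧ y (j + 1) 0 = y j 0 + z 0) ∨ (1 < y j 0 ∧ y (j + 1) 0 = y j 0 - z 0) := by
      rw [hy0 (j + 1)]
      rcases e3 with ⟨h1, h2⟩ | ⟨h1, h2⟩
      · exact Or.inl ⟨h1, by rw [hy0, h2]; push_cast; ring⟩
      · exact Or.inr ⟨h1, by rw [hy0, h2]; push_cast; ring⟩
    have d1 : y (j + 1) 1 = y j 1 + z 1 ∨ y (j + 1) 1 = y j 1 - z 1 := by
      rw [hy1 (j + 1), hy1 j]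
      have : s (j + 1) * |z 1| = s j * |z 1| + |z 1| ∨ s (j + 1) * |z 1| = s j * |z 1| - |z 1| := by
        rcases e4 with h1 | h1
        · left; rw [h1]; push_cast; ring
        · right; rw [h1]; push_cast; ring
      rcases abs_choice (z 1) with hb | hb <;> rw [hb] at this ⊢ <;> rcases this with h1 | h1 <;>
        rw [h1]
      · left; ring
      · right; ring
      · right; ring
      · left; ring
    rcases d0 with ⟨h1, h0⟩ | ⟨h1, h0⟩ <;> rcases d1 with h2 | h2
    · exact (right z h1 (ext2 _ _ h0 h2)).trans le_self_add
    · refine (right z' h1 (ext2 _ _ ?_ ?_)).trans le_add_self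
      · rw [PiLp.add_apply, hz'0, h0]
      · rw [PiLp.add_apply, hz'1, h2, sub_eq_add_neg]
    · refine (left z' h1 (ext2 _ _ ?_ ?_)).trans le_add_self
      · rw [PiLp.sub_apply, hz'0, h0]
      · rw [PiLp.sub_apply, hz'1, h2, sub_neg_eq_add]
    · exact (left z h1 (ext2 _ _ h0 h2)).trans le_self_add
  have htel : |u x| ≤ ∑ j ∈ Finset.range N, |u (y (j + 1)) - u (y j)| := by
    have h1 := Finset.sum_range_sub (fun j => u (y j)) N
    rw [huN, hyx] at h1
    calc |u x| = |∑ j ∈ Finset.range N, (u (y (j + 1)) - u (y j))| := by rw [h1]; simp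
      _ ≤ _ := Finset.abs_sum_le_sum_abs _ _
  have hpow : |u x| ^ p ≤ (2 / |z 1|) ^ (p - 1) *
      ∑ j ∈ Finset.range N, |u (y (j + 1)) - u (y j)| ^ p := by
    calc |u x| ^ p ≤ (∑ j ∈ Finset.range N, |u (y (j + 1)) - u (y j)|) ^ p :=
          Real.rpow_le_rpow (abs_nonneg _) htel (by linarith)
      _ ≤ (Finset.range N).card ^ (p - 1) *
            ∑ j ∈ Finset.range N, |u (y (j + 1)) - u (y j)| ^ p :=
          Real.rpow_sum_le_const_mul_sum_rpow _ _ hp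
      _ ≤ _ := by
          refine mul_le_mul_of_nonneg_right
            (Real.rpow_le_rpow (Nat.cast_nonneg _) ?_ (sub_nonneg.2 hp))
            (Finset.sum_nonneg fun j _ => Real.rpow_nonneg (abs_nonneg _) p)
          rw [Finset.card_range, le_div_iff₀ hz1]
          exact hN
  calc ENNReal.ofReal (|u x| ^ p)
      ≤ ENNReal.ofReal ((2 / |z 1|) ^ (p - 1) *
        ∑ j ∈ Finset.range N, |u (y (j + 1)) - u (y j)| ^ p) := ENNReal.ofReal_le_ofReal hpow
    _ = ENNReal.ofReal ((2 / |z 1|) ^ (p - 1)) *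
        ∑ j ∈ Finset.range N, ENNReal.ofReal (|u (y (j + 1)) - u (y j)| ^ p) := by
        rw [ENNReal.ofReal_mul (by positivity),
          ENNReal.ofReal_sum_of_nonneg fun j _ => by positivity]
    _ ≤ ENNReal.ofReal ((2 / |z 1|) ^ (p - 1)) * ∑ j ∈ Finset.range N,
        (stepEnergy p Ω₁ Ω₂ W u z (v (i j, s j)) + stepEnergy p Ω₁ Ω₂ W u z' (v (i j, s j))) := by
        gcongr with j hj
        rw [← hy]
        exact henergy j (Finset.mem_range.1 hj)
    _ ≤ _ := by
        gcongr
        rw [← Finset.sum_image (s := Finset.range N) (g := fun j => (i j, s j))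
          (f := fun k => stepEnergy p Ω₁ Ω₂ W u z (v k) + stepEnergy p Ω₁ Ω₂ W u z' (v k))]
        · refine Finset.sum_le_sum_of_subset fun k hk => ?_
          obtain ⟨j, hj, rfl⟩ := Finset.mem_image.1 hk
          obtain ⟨-, -, -, -, h5, h6⟩ := hstep j (Finset.mem_range.1 hj)
          rw [abs_le] at h5 h6
          simp only [Finset.mem_product, Finset.mem_Icc]
          exact ⟨h5, h6⟩
        · intro j hj l hl hjl
          simp only [Prod.mk.injEq] at hjl
          exact hinj j l (by simpa using hj) (by simpa using hl) hjl.1 hjl.2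

theorem lintegral_le_stepEnergy {p : ℝ} (hp : 1 ≤ p)
    {Ω Ω₁ Ω₂ U : Set (EuclideanSpace ℝ (Fin 2))}
    (hΩ : Ω = {x | x 0 ∈ Set.Ioo (0 : ℝ) 2 ∧ x 1 ∈ Set.Ioo (0 : ℝ) 2})
    (hΩ₁ : Ω₁ = {x | x 0 ∈ Set.Ioo (0 : ℝ) 1 ∧ x 1 ∈ Set.Ioo (0 : ℝ) 2})
    (hΩ₂ : Ω₂ = {x | x 0 ∈ Set.Ioo (1 : ℝ) 2 ∧ x 1 ∈ Set.Ioo (0 : ℝ) 2})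
    (hΩm : MeasurableSet Ω) (hΩ₁m : MeasurableSet Ω₁) (hΩ₂m : MeasurableSet Ω₂)
    (hUm : MeasurableSet U)
    {u : EuclideanSpace ℝ (Fin 2) → ℝ} (hum : Measurable u)
    {z z' : EuclideanSpace ℝ (Fin 2)}
    (hz' : z' = !₂[z 0, -z 1]) (hz1 : 0 < |z 1|) (hz10 : |z 1| < z 0) (hz0 : z 0 < 1)
    (hU : ∀ y : EuclideanSpace ℝ (Fin 2), y 0 ∈ Ioo (1 - z 0) (1 + z 0) →
      (y 1 ∈ Ioo (-1 : ℝ) 0 ∨ y 1 ∈ Ioo (2 : ℝ) 3) → y ∈ U)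
    (hu : ∀ᵐ y, y ∈ U → u y = 0) :
    ∫⁻ x in Ω, ENNReal.ofReal (|u x| ^ p) ≤
      ENNReal.ofReal (2 ^ (p + 3) * |z 1| ^ (-(p + 1))) *
        ((∫⁻ w, stepEnergy p Ω₁ Ω₂ (Ω ∪ U) u z w) +
          ∫⁻ w, stepEnergy p Ω₁ Ω₂ (Ω ∪ U) u z' w) := by
  have hgm := measurable_stepEnergy (p := p) hΩ₁m hΩ₂m (hΩm.union hUm) hum
  have hgz : ∀ ζ, Measurable (stepEnergy p Ω₁ Ω₂ (Ω ∪ U) u ζ) := fun ζ =>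
    hgm.comp (measurable_const.prodMk measurable_id)
  set B := Finset.Icc (-⌈1 / z 0⌉) ⌈1 / z 0⌉ ×ˢ
    Finset.Icc (-(⌈1 / |z 1|⌉ - 1)) (⌈1 / |z 1|⌉ - 1) with hB
  have hcard : (B.card : ℝ) ≤ 16 / |z 1| ^ 2 := card_lattice_box_le hz1 hz10 hz0
  have hlat : ∀ᵐ x : EuclideanSpace ℝ (Fin 2), ∀ k : ℤ × ℤ, x + !₂[k.1 * z 0, k.2 * |z 1|] ∈ U →
      u (x + !₂[k.1 * z 0, k.2 * |z 1|]) = 0 := by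
    rw [ae_all_iff]
    intro k
    exact (measurePreserving_add_right volume
      (!₂[k.1 * z 0, k.2 * |z 1|] : EuclideanSpace ℝ (Fin 2))).quasiMeasurePreserving.ae hu
  have hpt : ∀ᵐ x ∂volume.restrict Ω, ENNReal.ofReal (|u x| ^ p) ≤
      ENNReal.ofReal ((2 / |z 1|) ^ (p - 1)) * ∑ k ∈ B,
        (stepEnergy p Ω₁ Ω₂ (Ω ∪ U) u z (x + !₂[k.1 * z 0, k.2 * |z 1|]) +
          stepEnergy p Ω₁ Ω₂ (Ω ∪ U) u z' (x + !₂[k.1 * z 0, k.2 * |z 1|])) := by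
    rw [ae_restrict_iff' hΩm]
    filter_upwards [hlat, ae_coordinate_add_ne 0 (z 0) 1, ae_coordinate_add_ne 1 |z 1| 0,
      ae_coordinate_add_ne 1 |z 1| 2] with x h1 h2 h3 h4 hx
    rw [hΩ] at hx ⊢
    exact abs_rpow_le_sum_stepEnergy hp hΩ₁ hΩ₂ hz' hz1 hz10 hz0 hU hx.1 hx.2 h2 h3 h4 h1
  calc ∫⁻ x in Ω, ENNReal.ofReal (|u x| ^ p)
      ≤ ∫⁻ x in Ω, ENNReal.ofReal ((2 / |z 1|) ^ (p - 1)) * ∑ k ∈ B,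
        (stepEnergy p Ω₁ Ω₂ (Ω ∪ U) u z (x + !₂[k.1 * z 0, k.2 * |z 1|]) +
          stepEnergy p Ω₁ Ω₂ (Ω ∪ U) u z' (x + !₂[k.1 * z 0, k.2 * |z 1|])) :=
        lintegral_mono_ae hpt
    _ ≤ ∫⁻ x, ENNReal.ofReal ((2 / |z 1|) ^ (p - 1)) * ∑ k ∈ B,
        (stepEnergy p Ω₁ Ω₂ (Ω ∪ U) u z (x + !₂[k.1 * z 0, k.2 * |z 1|]) +
          stepEnergy p Ω₁ Ω₂ (Ω ∪ U) u z' (x + !₂[k.1 * z 0, k.2 * |z 1|])) :=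
        setLIntegral_le_lintegral _ _
    _ = ENNReal.ofReal ((2 / |z 1|) ^ (p - 1)) * ∑ k ∈ B,
        ((∫⁻ w, stepEnergy p Ω₁ Ω₂ (Ω ∪ U) u z w) +
          ∫⁻ w, stepEnergy p Ω₁ Ω₂ (Ω ∪ U) u z' w) := by
        rw [lintegral_const_mul' _ _ ENNReal.ofReal_ne_top, lintegral_finsetSum]
        · congr 1
          refine Finset.sum_congr rfl fun k _ => ?_
          rw [lintegral_add_left (by exact (hgz z).comp (measurable_add_const _)),
            lintegral_add_right_eq_self, lintegral_add_right_eq_self]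
        · intro k _
          exact ((hgz z).comp (measurable_add_const _)).add
            ((hgz z').comp (measurable_add_const _))
    _ ≤ _ := by
        rw [Finset.sum_const, nsmul_eq_mul, ← mul_assoc]
        gcongr
        rw [← ENNReal.ofReal_natCast, ← ENNReal.ofReal_mul (by positivity)]
        refine ENNReal.ofReal_le_ofReal ?_
        calc (2 / |z 1|) ^ (p - 1) * (B.card : ℝ)
            ≤ (2 / |z 1|) ^ (p - 1) * (16 / |z 1| ^ 2) := by gcongr
          _ = _ := by
            rw [Real.div_rpow (by norm_num) hz1.le, div_mul_div_comm, div_eq_mul_inv]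
            congr 1
            · rw [show p + 3 = (p - 1) + (4 : ℕ) by push_cast; ring,
                Real.rpow_add_natCast (by norm_num)]
              norm_num
            · rw [Real.rpow_neg hz1.le, show p + 1 = (p - 1) + (2 : ℕ) by push_cast; ring,
                Real.rpow_add_natCast hz1.ne']

theorem exists_reflection : ∃ R : EuclideanSpace ℝ (Fin 2) ≃ₗᵢ[ℝ] EuclideanSpace ℝ (Fin 2),
    ∀ z, R z = !₂[z 0, -z 1] := by
  refine ⟨LinearIsometryEquiv.piLpCongrRight 2 fun i : Fin 2 =>
    if i = 0 then LinearIsometryEquiv.refl ℝ ℝ else LinearIsometryEquiv.neg ℝ, fun z => ?_⟩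
  ext i
  fin_cases i <;> simp

theorem abs_snd_lt_fst_of_cos_mul_norm_lt {θ : ℝ} (hθ0 : 0 < θ) (hθ : θ ≤ Real.pi / 4)
    {z : EuclideanSpace ℝ (Fin 2)} (hz : Real.cos θ * ‖z‖ < z 0) : |z 1| < z 0 := by
  have hc : √2 / 2 ≤ Real.cos θ := by
    rw [← Real.cos_pi_div_four]
    exact Real.cos_le_cos_of_nonneg_of_le_pi hθ0.le (by linarith [Real.pi_pos]) hθ
  have hn : ‖z‖ ^ 2 = z 0 ^ 2 + z 1 ^ 2 := by
    simp [EuclideanSpace.norm_sq_eq, Fin.sum_univ_two]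
  have h2 : √2 / 2 * ‖z‖ < z 0 :=
    (mul_le_mul_of_nonneg_right hc (norm_nonneg z)).trans_lt hz
  have h0 : 0 ≤ √2 / 2 * ‖z‖ := by positivity
  have h3 : (√2 / 2 * ‖z‖) ^ 2 < z 0 ^ 2 := pow_lt_pow_left₀ h2 h0 two_ne_zero
  rw [mul_pow, div_pow, Real.sq_sqrt zero_le_two, hn] at h3
  exact abs_lt_of_sq_lt_sq (by linarith) (h0.trans h2.le)

theorem isOpen_truncated_cone (c δ₁ δ₂ : ℝ) :
    IsOpen {z : EuclideanSpace ℝ (Fin 2) | c * ‖z‖ < z 0 ∧ z 0 < δ₁ ∧ δ₂ < |z 1|} := by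
  have h0 : Continuous fun z : EuclideanSpace ℝ (Fin 2) => z 0 := by fun_prop
  have h1 : Continuous fun z : EuclideanSpace ℝ (Fin 2) => z 1 := by fun_prop
  exact (isOpen_lt (continuous_const.mul continuous_norm) h0).inter
    ((isOpen_lt h0 continuous_const).inter (isOpen_lt continuous_const h1.abs))

theorem truncated_cone_nonempty {θ δ₁ δ₂ : ℝ} (hθ0 : 0 < θ) (hθ : θ ≤ Real.pi / 4) (hδ₂0 : 0 < δ₂)
    (hδ₂ : δ₂ < δ₁ * Real.sin θ) :
    {z : EuclideanSpace ℝ (Fin 2) |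
      Real.cos θ * ‖z‖ < z 0 ∧ z 0 < δ₁ ∧ δ₂ < |z 1|}.Nonempty := by
  have hs : 0 < Real.sin θ := Real.sin_pos_of_pos_of_lt_pi hθ0 (by linarith [Real.pi_pos])
  obtain ⟨c, hc1, hc2⟩ := exists_between hδ₂
  have hc0 : 0 < c := hδ₂0.trans hc1
  refine ⟨!₂[c / Real.sin θ, c], ?_, ?_, ?_⟩
  · have hn : ‖(!₂[c / Real.sin θ, c] : EuclideanSpace ℝ (Fin 2))‖ ^ 2 =
        (c / Real.sin θ) ^ 2 + c ^ 2 := by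
      simp [EuclideanSpace.norm_sq_eq, Fin.sum_univ_two]
    refine lt_of_pow_lt_pow_left₀ 2 (by simp; positivity) ?_
    rw [mul_pow, hn, Real.cos_sq']
    simp only [Matrix.cons_val_zero]
    have e : (1 - Real.sin θ ^ 2) * ((c / Real.sin θ) ^ 2 + c ^ 2) =
        (c / Real.sin θ) ^ 2 - c ^ 2 * Real.sin θ ^ 2 := by
      field_simp; ring
    rw [e]
    have : 0 < c ^ 2 * Real.sin θ ^ 2 := by positivity
    linarith
  · simpa [div_lt_iff₀ hs] using hc2
  · simpa [abs_of_pos hc0] using hc1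

theorem volume_truncated_cone_ne_top {θ δ₁ δ₂ : ℝ} (hθ0 : 0 < θ) (hθ : θ ≤ Real.pi / 4) :
    volume {z : EuclideanSpace ℝ (Fin 2) |
      Real.cos θ * ‖z‖ < z 0 ∧ z 0 < δ₁ ∧ δ₂ < |z 1|} ≠ ∞ := by
  refine ((measure_mono fun z hz => ?_).trans_lt
    (measure_ball_lt_top (x := (0 : EuclideanSpace ℝ (Fin 2))) (r := 2 * δ₁))).ne
  have h1 := abs_snd_lt_fst_of_cos_mul_norm_lt hθ0 hθ hz.1
  have hn : ‖z‖ ^ 2 = z 0 ^ 2 + z 1 ^ 2 := by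
    simp [EuclideanSpace.norm_sq_eq, Fin.sum_univ_two]
  have h0 : 0 < z 0 := (abs_nonneg _).trans_lt h1
  have h2 := hz.2.1
  rw [mem_ball_zero_iff]
  refine lt_of_pow_lt_pow_left₀ 2 (by linarith) ?_
  have h3 : z 1 ^ 2 < z 0 ^ 2 := by rw [← sq_abs (z 1)]; gcongr
  nlinarith

theorem setLIntegral_cone_stepEnergy_le {p : ℝ} {Ω Ω₁ Ω₂ W Z Z' : Set (EuclideanSpace ℝ (Fin 2))}
    (hWm : MeasurableSet W) (hZm : MeasurableSet Z)
    (h₁ : Ω₁ ⊆ Ω) (h₂ : Ω₂ ⊆ Ω) (h₁₂ : Disjoint Ω₁ Ω₂) (hZ' : Z' = -Z)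
    {Ψ : EuclideanSpace ℝ (Fin 2) → Set (EuclideanSpace ℝ (Fin 2))}
    (hΨ₁ : ∀ x ∈ Ω₁, Ψ x = W ∩ (fun w => x + w) '' Z)
    (hΨ₂ : ∀ x ∈ Ω₂, Ψ x = W ∩ (fun w => x + w) '' Z')
    {u : EuclideanSpace ℝ (Fin 2) → ℝ} (κ : ℝ → ℝ≥0∞)
    (x : EuclideanSpace ℝ (Fin 2)) :
    ∫⁻ z in Z, κ |z 1| * stepEnergy p Ω₁ Ω₂ W u z x ≤
      Ω.indicator (fun x => ∫⁻ y in Ψ x, κ |y 1 - x 1| * ENNReal.ofReal (|u y - u x| ^ p)) x := by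
  by_cases hx₁ : x ∈ Ω₁
  · have hm : MeasurableSet ((fun w => x + w) '' Z) := by
      rw [image_add_left]; exact measurable_const_add _ hZm
    rw [indicator_of_mem (h₁ hx₁), hΨ₁ x hx₁, ← lintegral_indicator (hWm.inter hm),
      ← lintegral_indicator hZm,
      ← lintegral_add_left_eq_self ((W ∩ (fun w => x + w) '' Z).indicator _) x]
    refine lintegral_mono fun z => ?_
    by_cases hz : z ∈ Z
    · rw [indicator_of_mem hz, stepEnergy, indicator_of_mem hx₁,
        indicator_of_notMem (disjoint_left.1 h₁₂ hx₁), add_zero]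
      by_cases hW : x + z ∈ W
      · have hmem : x + z ∈ W ∩ (fun w => x + w) '' Z := ⟨hW, z, hz, rfl⟩
        rw [indicator_of_mem hW, indicator_of_mem hmem]
        simp
      · rw [indicator_of_notMem hW]; simp
    · rw [indicator_of_notMem hz]; exact zero_le
  by_cases hx₂ : x ∈ Ω₂
  · have hm : MeasurableSet ((fun w => x + w) '' Z') := by
      rw [image_add_left, hZ']; exact measurable_const_add _ hZm.neg
    rw [indicator_of_mem (h₂ hx₂), hΨ₂ x hx₂, ← lintegral_indicator (hWm.inter hm),
      ← lintegral_indicator hZm,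
      ← lintegral_sub_left_eq_self ((W ∩ (fun w => x + w) '' Z').indicator _) x]
    refine lintegral_mono fun z => ?_
    by_cases hz : z ∈ Z
    · rw [indicator_of_mem hz, stepEnergy, indicator_of_mem hx₂,
        indicator_of_notMem hx₁, zero_add]
      by_cases hW : x - z ∈ W
      · have hmem : x - z ∈ W ∩ (fun w => x + w) '' Z' :=
          ⟨hW, -z, by simpa [hZ'] using hz, (sub_eq_add_neg x z).symm⟩
        rw [indicator_of_mem hW, indicator_of_mem hmem]
        simp
      · rw [indicator_of_notMem hW]; simp
    · rw [indicator_of_notMem hz]; exact zero_le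
  · simp [stepEnergy, hx₁, hx₂]

/-- Poincaré inequality with kernel supports that change
discontinuously across an interface (`Ex:Discontinuous`), in `ℝ²`. -/
theorem stmt18 (p : ℝ) (hp : 1 ≤ p)
    (Ω Ω₁ Ω₂ : Set (EuclideanSpace ℝ (Fin 2)))
    (hΩ : Ω = {x | x 0 ∈ Set.Ioo (0 : ℝ) 2 ∧ x 1 ∈ Set.Ioo (0 : ℝ) 2})
    (hΩ₁ : Ω₁ = {x | x 0 ∈ Set.Ioo (0 : ℝ) 1 ∧ x 1 ∈ Set.Ioo (0 : ℝ) 2})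
    (hΩ₂ : Ω₂ = {x | x 0 ∈ Set.Ioo (1 : ℝ) 2 ∧ x 1 ∈ Set.Ioo (0 : ℝ) 2})
    (δ₁ : ℝ) (hδ₁0 : 0 < δ₁) (hδ₁1 : δ₁ < 1)
    (U₁ U₂ U : Set (EuclideanSpace ℝ (Fin 2)))
    (hU₁ : U₁ = {x | x 0 ∈ Set.Ioo (1 - δ₁) (1 + δ₁) ∧ x 1 ∈ Set.Ioo (-1 : ℝ) 0})
    (hU₂ : U₂ = {x | x 0 ∈ Set.Ioo (1 - δ₁) (1 + δ₁) ∧ x 1 ∈ Set.Ioo (2 : ℝ) 3})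
    (hU : U = U₁ ∪ U₂)
    (θ : ℝ) (hθ0 : 0 < θ) (hθ : θ ≤ Real.pi / 4)
    (δ₂ : ℝ) (hδ₂0 : 0 < δ₂) (hδ₂ : δ₂ < δ₁ * Real.sin θ)
    (Z₁ Z₂ : Set (EuclideanSpace ℝ (Fin 2)))
    (hZ₁ : Z₁ = {z | Real.cos θ * ‖z‖ < z 0 ∧ z 0 < δ₁ ∧ δ₂ < |z 1|})
    (hZ₂ : Z₂ = -Z₁)
    (Ψ : EuclideanSpace ℝ (Fin 2) → Set (EuclideanSpace ℝ (Fin 2)))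
    (hΨ₁ : ∀ x ∈ Ω₁, Ψ x = (Ω ∪ U) ∩ (fun w => x + w) '' Z₁)
    (hΨ₂ : ∀ x ∈ Ω₂, Ψ x = (Ω ∪ U) ∩ (fun w => x + w) '' Z₂)
    (μ : EuclideanSpace ℝ (Fin 2) → EuclideanSpace ℝ (Fin 2) → ℝ)
    (hμmeas : Measurable (Function.uncurry μ)) (hμ0 : ∀ x w, 0 ≤ μ x w)
    (C : ℝ)
    (hμC : ∀ᵐ x ∂(volume.restrict Ω), ∀ᵐ y ∂(volume.restrict (Ψ x)),
      |y 1 - x 1| ^ (-(p + 1)) / (volume Z₁).toReal ≤ μ x (y - x) * C)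
    (u : EuclideanSpace ℝ (Fin 2) → ℝ) (humeas : Measurable u)
    (hu0 : ∀ᵐ x, x ∈ U → u x = 0) :
    ∫⁻ x in Ω, ENNReal.ofReal (|u x| ^ p) ≤
      ENNReal.ofReal ((2 : ℝ) ^ (p + 4) * C) *
        ∫⁻ x in Ω, ∫⁻ y in Ψ x, ENNReal.ofReal (|u y - u x| ^ p * μ x (y - x)) := by
  have open_box : ∀ a b c d : ℝ,
      IsOpen {x : EuclideanSpace ℝ (Fin 2) | x 0 ∈ Ioo a b ∧ x 1 ∈ Ioo c d} := fun a b c d =>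
    (isOpen_Ioo.preimage (by fun_prop)).inter (isOpen_Ioo.preimage (by fun_prop))
  have hΩm : MeasurableSet Ω := hΩ ▸ (open_box _ _ _ _).measurableSet
  have hΩ₁m : MeasurableSet Ω₁ := hΩ₁ ▸ (open_box _ _ _ _).measurableSet
  have hΩ₂m : MeasurableSet Ω₂ := hΩ₂ ▸ (open_box _ _ _ _).measurableSet
  have hUm : MeasurableSet U := by
    rw [hU, hU₁, hU₂]
    exact ((open_box _ _ _ _).union (open_box _ _ _ _)).measurableSet
  have hWm : MeasurableSet (Ω ∪ U) := hΩm.union hUm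
  have hZo : IsOpen Z₁ := hZ₁ ▸ isOpen_truncated_cone _ _ _
  have hZm : MeasurableSet Z₁ := hZo.measurableSet
  have hV0 : volume Z₁ ≠ 0 :=
    (hZo.measure_pos volume (hZ₁ ▸ truncated_cone_nonempty hθ0 hθ hδ₂0 hδ₂)).ne'
  have hVtop : volume Z₁ ≠ ∞ := hZ₁ ▸ volume_truncated_cone_ne_top hθ0 hθ
  have hVr : 0 < (volume Z₁).toReal := ENNReal.toReal_pos hV0 hVtop
  obtain ⟨R, hR⟩ := exists_reflection
  have hRZ : R ⁻¹' Z₁ = Z₁ := by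
    ext z
    rw [mem_preimage, hZ₁, mem_ofPred_eq, mem_ofPred_eq, R.norm_map, hR]
    simp
  set κ : ℝ → ℝ≥0∞ := fun h => ENNReal.ofReal (h ^ (-(p + 1))) with hκ
  have hκm : Measurable fun z : EuclideanSpace ℝ (Fin 2) => κ |z 1| := by
    have h1 : Measurable fun z : EuclideanSpace ℝ (Fin 2) => |z 1| :=
      (by fun_prop : Continuous fun z : EuclideanSpace ℝ (Fin 2) => |z 1|).measurable
    exact (h1.pow_const _).ennreal_ofReal
  set g := stepEnergy p Ω₁ Ω₂ (Ω ∪ U) u with hg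
  have hgm : Measurable (Function.uncurry g) := measurable_stepEnergy hΩ₁m hΩ₂m hWm humeas
  have hGm : Measurable fun z => ∫⁻ w, g z w := hgm.lintegral_prod_right'
  have hIm : Measurable fun z : EuclideanSpace ℝ (Fin 2) => κ |z 1| * ∫⁻ w, g z w := hκm.mul hGm
  set I := ∫⁻ z in Z₁, κ |z 1| * ∫⁻ w, g z w with hI
  have hrefl : ∫⁻ z in Z₁, κ |z 1| * ∫⁻ w, g (R z) w = I := by
    rw [hI, ← R.measurePreserving.setLIntegral_comp_preimage hZm hIm, hRZ]
    refine lintegral_congr fun z => ?_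
    rw [show (R z) 1 = -z 1 by simp [hR], abs_neg]
  have hfiber : ∀ z ∈ Z₁, ∫⁻ x in Ω, ENNReal.ofReal (|u x| ^ p) ≤
      ENNReal.ofReal (2 ^ (p + 3)) * (κ |z 1| * (∫⁻ w, g z w) + κ |z 1| * ∫⁻ w, g (R z) w) := by
    intro z hz
    rw [hZ₁] at hz
    obtain ⟨hz1, hz2, hz3⟩ := hz
    rw [← mul_add, ← mul_assoc, ← ENNReal.ofReal_mul (by positivity)]
    refine lintegral_le_stepEnergy hp hΩ hΩ₁ hΩ₂ hΩm hΩ₁m hΩ₂m hUm humeas (hR z)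
      (hδ₂0.trans hz3) (abs_snd_lt_fst_of_cos_mul_norm_lt hθ0 hθ hz1) (hz2.trans hδ₁1) ?_ hu0
    intro y hy0 hy1
    have hy0' : y 0 ∈ Ioo (1 - δ₁) (1 + δ₁) := ⟨by linarith [hy0.1], by linarith [hy0.2]⟩
    rw [hU, hU₁, hU₂]
    exact hy1.imp (fun h => ⟨hy0', h⟩) fun h => ⟨hy0', h⟩
  have hbound : volume Z₁ * ∫⁻ x in Ω, ENNReal.ofReal (|u x| ^ p) ≤
      ENNReal.ofReal (2 ^ (p + 4)) * I := by
    calc volume Z₁ * ∫⁻ x in Ω, ENNReal.ofReal (|u x| ^ p)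
        = ∫⁻ _ in Z₁, ∫⁻ x in Ω, ENNReal.ofReal (|u x| ^ p) := by
          rw [setLIntegral_const, mul_comm]
      _ ≤ ∫⁻ z in Z₁, ENNReal.ofReal (2 ^ (p + 3)) *
            (κ |z 1| * (∫⁻ w, g z w) + κ |z 1| * ∫⁻ w, g (R z) w) :=
          setLIntegral_mono' hZm hfiber
      _ = ENNReal.ofReal (2 ^ (p + 3)) * (I + I) := by
          rw [lintegral_const_mul' _ _ ENNReal.ofReal_ne_top, lintegral_add_left hIm, hrefl]
      _ = _ := by
          rw [← two_mul, ← mul_assoc, show p + 4 = (p + 3) + 1 by ring,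
            Real.rpow_add_one two_ne_zero, ENNReal.ofReal_mul (by positivity)]
          simp
  have hswap : I ≤ ∫⁻ x in Ω, ∫⁻ y in Ψ x, κ |y 1 - x 1| * ENNReal.ofReal (|u y - u x| ^ p) := by
    have hdisj : Disjoint Ω₁ Ω₂ := by
      rw [hΩ₁, hΩ₂, disjoint_left]
      exact fun x h1 h2 => lt_asymm h1.1.2 h2.1.1
    have hsub₁ : Ω₁ ⊆ Ω := by
      rw [hΩ₁, hΩ]
      exact fun x h => ⟨⟨h.1.1, h.1.2.trans one_lt_two⟩, h.2⟩
    have hsub₂ : Ω₂ ⊆ Ω := by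
      rw [hΩ₂, hΩ]
      exact fun x h => ⟨⟨zero_lt_one.trans h.1.1, h.1.2⟩, h.2⟩
    calc I = ∫⁻ z in Z₁, ∫⁻ x, κ |z 1| * g z x :=
          lintegral_congr fun z => (lintegral_const_mul' _ _ ENNReal.ofReal_ne_top).symm
      _ = ∫⁻ x, ∫⁻ z in Z₁, κ |z 1| * g z x :=
          lintegral_lintegral_swap ((hκm.comp measurable_fst).mul hgm).aemeasurable
      _ ≤ ∫⁻ x, Ω.indicator
            (fun x => ∫⁻ y in Ψ x, κ |y 1 - x 1| * ENNReal.ofReal (|u y - u x| ^ p)) x :=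
          lintegral_mono fun x => setLIntegral_cone_stepEnergy_le hWm hZm hsub₁ hsub₂ hdisj hZ₂ hΨ₁
            hΨ₂ κ x
      _ = _ := lintegral_indicator hΩm _
  have hkernel : (∫⁻ x in Ω, ∫⁻ y in Ψ x, κ |y 1 - x 1| * ENNReal.ofReal (|u y - u x| ^ p)) ≤
      volume Z₁ * ENNReal.ofReal C *
        ∫⁻ x in Ω, ∫⁻ y in Ψ x, ENNReal.ofReal (|u y - u x| ^ p * μ x (y - x)) := by
    have htop : volume Z₁ * ENNReal.ofReal C ≠ ∞ := ENNReal.mul_ne_top hVtop ENNReal.ofReal_ne_top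
    rw [← lintegral_const_mul' _ _ htop]
    refine lintegral_mono_ae ?_
    filter_upwards [hμC] with x hx
    rw [← lintegral_const_mul' _ _ htop]
    refine lintegral_mono_ae ?_
    filter_upwards [hx] with y hy
    have h1 : κ |y 1 - x 1| ≤ volume Z₁ * (ENNReal.ofReal (μ x (y - x)) * ENNReal.ofReal C) := by
      rw [← ENNReal.ofReal_mul (hμ0 _ _), ← ENNReal.ofReal_toReal hVtop,
        ← ENNReal.ofReal_mul hVr.le]
      refine ENNReal.ofReal_le_ofReal ?_
      rwa [div_le_iff₀' hVr] at hy
    rw [ENNReal.ofReal_mul (by positivity)]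
    calc _ ≤ volume Z₁ * (ENNReal.ofReal (μ x (y - x)) * ENNReal.ofReal C) *
          ENNReal.ofReal (|u y - u x| ^ p) := by gcongr
      _ = _ := by ring
  rw [ENNReal.ofReal_mul (by positivity)]
  refine (ENNReal.mul_le_mul_iff_right hV0 hVtop).1 ?_
  calc _ ≤ ENNReal.ofReal (2 ^ (p + 4)) * I := hbound
    _ ≤ ENNReal.ofReal (2 ^ (p + 4)) * (volume Z₁ * ENNReal.ofReal C *
        ∫⁻ x in Ω, ∫⁻ y in Ψ x, ENNReal.ofReal (|u y - u x| ^ p * μ x (y - x))) := by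
      gcongr
      exact hswap.trans hkernel
    _ = _ := by ring
end
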